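/- arXiv:2603.06076 — 8 statements merged into one kernel-verified Lean document; each statement's English description precedes it below -/
import Mathlib

section
/- If f : V^N → ℝ is a C^N-function, then for all a, b ∈ V^N there exists c ∈ P(a,b) = ∏_{n ∈ N} [a_n, b_n] (the product over n ∈ N of the straight-line segments in ℝ^K joining a_n to b_n) such that □f(a,b) = ∇_N f(c)(b−a)^N = ∑_{k ∈ K^N} ∂̃_k f(c) ∏_{n ∈ N} (b_{n,k_n} − a_{n,k_n}). -/
open MeasureTheory

/-- The multidimensional increment `□f(x,y) = ∑_{M ⊆ N} (−1)^{|M|} f(π_M(x,y))`,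
where `π_M(x,y)(n) = x n` if `n ∈ M` and `y n` otherwise. -/
noncomputable def mwBoxIncr {N : Type*} [Fintype N] [DecidableEq N] {α : Type*}
    (f : (N → α) → ℝ) (x y : N → α) : ℝ :=
  ∑ M : Finset N, (-1 : ℝ) ^ M.card * f (fun n => if n ∈ M then x n else y n)

/-- The multidimensional increment for grouped coordinates `V^N = ℝ^{N×K}`:
subsets `M` range over the first factor only. -/
noncomputable def mwBoxIncrG {r s : ℕ} (f : (Fin r × Fin s → ℝ) → ℝ)
    (x y : Fin r × Fin s → ℝ) : ℝ :=
  ∑ M : Finset (Fin r), (-1 : ℝ) ^ M.card * f (fun l => if l.1 ∈ M then x l else y l)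

/-- Partial derivative of `f` in the coordinate `l`. -/
noncomputable def mwPD {ι : Type*} [DecidableEq ι] (l : ι) (f : (ι → ℝ) → ℝ) :
    (ι → ℝ) → ℝ :=
  fun x => deriv (fun t => f (Function.update x l t)) (x l)

/-- Iterated partial derivative along a list of coordinates (leftmost applied last). -/
noncomputable def mwIterPD {ι : Type*} [DecidableEq ι] (ls : List ι)
    (f : (ι → ℝ) → ℝ) : (ι → ℝ) → ℝ :=
  ls.foldr mwPD f

/-- Existence (everywhere) of the iterated partial derivative along a list. -/
def mwExistsIterPD {ι : Type*} [DecidableEq ι] : List ι → ((ι → ℝ) → ℝ) → Prop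
  | [], _ => True
  | l :: ls, f => mwExistsIterPD ls f ∧
      ∀ x, DifferentiableAt ℝ (fun t => mwIterPD ls f (Function.update x l t)) (x l)

/-- `f : ℝ^N → ℝ` is a `C^N`-function (case `s = 1`): for every `M ⊆ N`, `∂_M f`
exists everywhere and is continuous. -/
def mwIsCN {r : ℕ} (f : (Fin r → ℝ) → ℝ) : Prop :=
  ∀ M : Finset (Fin r),
    mwExistsIterPD (M.sort (· ≤ ·)) f ∧ Continuous (mwIterPD (M.sort (· ≤ ·)) f)

/-- `∂_N f = ∂_1 ⋯ ∂_r f`. -/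
noncomputable def mwDN {r : ℕ} (f : (Fin r → ℝ) → ℝ) : (Fin r → ℝ) → ℝ :=
  mwIterPD ((Finset.univ : Finset (Fin r)).sort (· ≤ ·)) f

/-- `f : V^N → ℝ` (with `V = ℝ^K`) is a `C^N`-function: for every `M ⊆ N` and
`k ∈ K^M`, the iterated partial derivative `∂̃_k f` exists everywhere and is continuous. -/
def mwIsCNG {r s : ℕ} (f : (Fin r × Fin s → ℝ) → ℝ) : Prop :=
  ∀ (M : Finset (Fin r)) (k : Fin r → Fin s),
    mwExistsIterPD ((M.sort (· ≤ ·)).map (fun m => (m, k m))) f ∧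
    Continuous (mwIterPD ((M.sort (· ≤ ·)).map (fun m => (m, k m))) f)

/-- `γ^{i_1} ∘ ⋯ ∘ γ^{i_p}` for a multi-index `i ∈ I^p`. -/
def mwComp {I β : Type*} (γ : I → β → β) {p : ℕ} (i : Fin p → I) : β → β :=
  (List.ofFn i).foldr (fun j g => γ j ∘ g) id

/-- `Q(a,b) = ∏_{n} [a_n, b_n)`. -/
def mwQ {r : ℕ} (a b : Fin r → ℝ) : Set (Fin r → ℝ) :=
  {z | ∀ n, a n ≤ z n ∧ z n < b n}

/-- `Π(x,y) = ∏_n {x_n, y_n}`. -/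
def mwPi {N α : Type*} (x y : N → α) : Set (N → α) :=
  {z | ∀ n, z n = x n ∨ z n = y n}

/-- `Π(x,y) = ∏_n {x_n, y_n}` for grouped coordinates, `x_n ∈ V = ℝ^K`. -/
def mwPiG {r s : ℕ} (x y : Fin r × Fin s → ℝ) : Set (Fin r × Fin s → ℝ) :=
  {z | ∀ n : Fin r, (∀ k, z (n, k) = x (n, k)) ∨ (∀ k, z (n, k) = y (n, k))}

/-- Euclidean norm on `ℝ^N`. -/
noncomputable def mwNorm {r : ℕ} (x : Fin r → ℝ) : ℝ := Real.sqrt (∑ n, x n ^ 2)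

/-- Euclidean diameter of a subset of `ℝ^N`. -/
noncomputable def mwDiam {r : ℕ} (T : Set (Fin r → ℝ)) : ℝ :=
  sSup {d | ∃ u ∈ T, ∃ v ∈ T, d = mwNorm (u - v)}

/-- `ω_T(g,δ) = sup {|g(u) − g(v)| : u ∈ T, ‖u − v‖ < δ}`. -/
noncomputable def mwOmega {r : ℕ} (T : Set (Fin r → ℝ)) (g : (Fin r → ℝ) → ℝ)
    (δ : ℝ) : ℝ :=
  sSup {d | ∃ u ∈ T, ∃ v, mwNorm (u - v) < δ ∧ d = |g u - g v|}

/-- `𝕄^p f(x) = ∑_{i ∈ I^p} □f(γ^i(0), γ^i(x))`. -/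
noncomputable def mwMWp {r : ℕ} {I : Type*} (γ : I → (Fin r → ℝ) → (Fin r → ℝ))
    (f : (Fin r → ℝ) → ℝ) (p : ℕ) (x : Fin r → ℝ) : ℝ :=
  ∑' i : Fin p → I, mwBoxIncr f (mwComp γ i 0) (mwComp γ i x)

/-- Iterates of the MW-operator: `𝕄^0 f = f`,
`𝕄^{k+1} f(x) = ∑_{i ∈ I} □(𝕄^k f)(γ^i(0), γ^i(x))`. -/
noncomputable def mwMWiter {N α I : Type*} [Fintype N] [DecidableEq N] [Zero α]
    (γ : I → (N → α) → (N → α)) (f : (N → α) → ℝ) : ℕ → ((N → α) → ℝ)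
  | 0 => f
  | k + 1 => fun x => ∑' i : I, mwBoxIncr (mwMWiter γ f k) (γ i 0) (γ i x)

open Finset in
/-- The mean value theorem, iterated one coordinate at a time: if `F (insert n S)` is the derivative
of `F S` in the coordinate `n` for all `n` below `S`, then the increment of `F ∅` over the unit cube
is a value of `F univ`. -/
theorem exists_sum_eq_of_hasDerivAt {r : ℕ} (F : Finset (Fin r) → (Fin r → ℝ) → ℝ)
    (hF : ∀ (n : Fin r) (S : Finset (Fin r)), (∀ m ∈ S, n < m) → ∀ τ t,
      HasDerivAt (fun t => F S (Function.update τ n t)) (F (insert n S) (Function.update τ n t)) t)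
    (S : Finset (Fin r)) :
    ∃ θ : Fin r → ℝ, (∀ n, θ n ∈ Set.Icc (0 : ℝ) 1) ∧
      ∑ M : Finset (Fin r), (-1 : ℝ) ^ M.card * F ∅ (fun n => if n ∈ M then 0 else 1) =
        ∑ M ∈ Sᶜ.powerset, (-1 : ℝ) ^ M.card *
          F S (fun n => if n ∈ S then θ n else if n ∈ M then 0 else 1) := by
  induction S using Finset.induction_on_min with
  | empty => exact ⟨0, by simp, by simp⟩
  | insert n S hn ih =>
    obtain ⟨θ, hθ, hsum⟩ := ih
    have hnS : n ∉ S := fun h => lt_irrefl _ (hn n h)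
    have hnT : n ∉ (insert n S)ᶜ := by simp
    have hcompl : Sᶜ = insert n (insert n S)ᶜ := by
      ext m; by_cases h : m = n <;> simp [h, hnS]
    let τ (M : Finset (Fin r)) : Fin r → ℝ :=
      fun m => if m ∈ S then θ m else if m ∈ M then 0 else 1
    let φ (t : ℝ) : ℝ :=
      ∑ M ∈ (insert n S)ᶜ.powerset, (-1 : ℝ) ^ M.card * F S (Function.update (τ M) n t)
    let φ' (t : ℝ) : ℝ :=
      ∑ M ∈ (insert n S)ᶜ.powerset,
        (-1 : ℝ) ^ M.card * F (insert n S) (Function.update (τ M) n t)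
    have hφ (t : ℝ) : HasDerivAt φ (φ' t) t :=
      HasDerivAt.fun_sum fun M _ => (hF n S hn (τ M) t).const_mul _
    obtain ⟨t, ht, hmvt⟩ := exists_hasDerivAt_eq_slope φ φ' zero_lt_one
      (fun t _ => (hφ t).continuousAt.continuousWithinAt) (fun t _ => hφ t)
    refine ⟨Function.update θ n t, fun m => ?_, ?_⟩
    · by_cases h : m = n
      · subst h; simpa using ⟨ht.1.le, ht.2.le⟩
      · simpa [h] using hθ m
    · have hincr : ∑ M ∈ Sᶜ.powerset, (-1 : ℝ) ^ M.card * F S (τ M) = φ 1 - φ 0 := by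
        rw [hcompl, sum_powerset_insert hnT, sub_eq_add_neg, ← sum_neg_distrib]
        congr 1 <;> refine sum_congr rfl fun M hM => ?_
        · have hnM : n ∉ M := fun h => hnT (mem_powerset.1 hM h)
          congr 2
          ext m; by_cases h : m = n <;> simp [τ, h, hnS, hnM]
        · have hnM : n ∉ M := fun h => hnT (mem_powerset.1 hM h)
          have : τ (insert n M) = Function.update (τ M) n 0 := by
            ext m; by_cases h : m = n <;> simp [τ, h, hnS]
          rw [this, card_insert_of_notMem hnM, pow_succ]
          ring
      rw [hsum, hincr]
      simp only [sub_zero, div_one] at hmvt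
      rw [← hmvt]
      refine sum_congr rfl fun M _ => ?_
      congr 2
      ext m; by_cases h : m = n <;> simp [τ, h]

/-- The derivative of `g` along a coordinate line. -/
theorem hasDerivAt_add_smul_single {ι : Type*} [DecidableEq ι] {g : (ι → ℝ) → ℝ} {l : ι}
    (hd : ∀ x, DifferentiableAt ℝ (fun t => g (Function.update x l t)) (x l))
    (c : ℝ) (x : ι → ℝ) (t : ℝ) :
    HasDerivAt (fun t => g (x + t • Pi.single l c))
      (mwPD l g (x + t • Pi.single l c) * c) t := by
  have hline (t : ℝ) : x + t • Pi.single l c = Function.update x l (x l + t * c) := by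
    ext m
    by_cases h : m = l
    · subst h; simp
    · simp [h]
  have hg := (hd (x + t • Pi.single l c)).hasDerivAt
  simp only [hline, Function.update_idem, Function.update_self] at hg
  have hlin : HasDerivAt (fun t : ℝ => x l + t * c) c t := by
    simpa using ((hasDerivAt_id t).mul_const c).const_add (x l)
  have := HasDerivAt.comp t hg hlin
  simpa [mwPD, hline, Function.comp_def] using this

/-- The chain rule along a line in the span of finitely many coordinate directions in which the
partial derivatives of `g` exist and are continuous. -/
theorem hasDerivAt_add_smul_sum_single {ι : Type*} [DecidableEq ι] {g : (ι → ℝ) → ℝ}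
    (v : ι → ℝ) (A : Finset ι)
    (hd : ∀ l ∈ A, ∀ x, DifferentiableAt ℝ (fun t => g (Function.update x l t)) (x l))
    (hc : ∀ l ∈ A, Continuous (mwPD l g)) (x : ι → ℝ) (t : ℝ) :
    HasDerivAt (fun t => g (x + t • ∑ l ∈ A, Pi.single l (v l)))
      (∑ l ∈ A, mwPD l g (x + t • ∑ l ∈ A, Pi.single l (v l)) * v l) t := by
  induction A using Finset.induction_on generalizing x t with
  | empty => simpa using hasDerivAt_const t (g x)
  | insert l A hl ih =>
    simp only [Finset.mem_insert, forall_eq_or_imp] at hd hc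
    set w : ι → ℝ := ∑ l ∈ A, Pi.single l (v l)
    let y (p q : ℝ) : ι → ℝ := x + q • Pi.single l (v l) + p • w
    have hy : Continuous fun z : ℝ × ℝ => y z.1 z.2 := by
      fun_prop
    let f₁ (p q : ℝ) : ℝ →L[ℝ] ℝ :=
      ContinuousLinearMap.toSpanSingleton ℝ (∑ m ∈ A, mwPD m g (y p q) * v m)
    let f₂ (p q : ℝ) : ℝ →L[ℝ] ℝ :=
      ContinuousLinearMap.toSpanSingleton ℝ (mwPD l g (y p q) * v l)
    have hspan : Continuous fun c : ℝ => ContinuousLinearMap.toSpanSingleton ℝ c :=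
      (ContinuousLinearMap.toSpanSingletonCLE (𝕜 := ℝ) (E := ℝ)).continuous
    have hf₁ : Continuous ↿f₁ := hspan.comp <|
      continuous_finsetSum A fun m hm => ((hc.2 m hm).comp hy).mul continuous_const
    have hf₂ : Continuous ↿f₂ := hspan.comp ((hc.1.comp hy).mul continuous_const)
    have h := hasStrictFDerivAt_uncurry_coprod (𝕜 := ℝ) (u := (t, t)) (f := fun p q => g (y p q))
      (f₁ := f₁) (f₂ := f₂)
      (.of_forall fun z => (ih hd.2 hc.2 (x + z.2 • Pi.single l (v l)) z.1).hasFDerivAt)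
      (.of_forall fun z => by
        have := (hasDerivAt_add_smul_single hd.1 (v l) (x + z.1 • w) z.2).hasFDerivAt
        simp only [add_right_comm x (z.1 • w)] at this
        exact this)
      hf₁.continuousAt hf₂.continuousAt
    have hdiag : HasDerivAt (fun t : ℝ => (t, t)) (1, 1) t :=
      (hasDerivAt_id t).prodMk (hasDerivAt_id t)
    have hcomp := HasFDerivAt.comp_hasDerivAt (f := fun t : ℝ => (t, t)) t h.hasFDerivAt hdiag
    have hline (t : ℝ) : x + t • (Pi.single l (v l) + w) = y t t := by
      simp only [smul_add, y]
      abel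
    rw [Finset.sum_insert hl, Finset.sum_insert hl]
    change HasDerivAt (fun t => g (x + t • (Pi.single l (v l) + w))) _ t
    simp only [hline]
    refine hcomp.congr_deriv ?_
    change (1 : ℝ) • (∑ m ∈ A, mwPD m g (y t t) * v m) + (1 : ℝ) • (mwPD l g (y t t) * v l) = _
    simp only [one_smul, add_comm (∑ m ∈ A, _), ← hline, w]

/-- The point of the box `∏ n, [a n, b n]` with barycentric coordinates `τ`. -/
def boxPoint {r s : ℕ} (a b : Fin r × Fin s → ℝ) (τ : Fin r → ℝ) : Fin r × Fin s → ℝ :=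
  fun l => a l + τ l.1 * (b l - a l)

/-- The chain rule in the barycentric coordinate of one block. -/
theorem hasDerivAt_boxPoint_update {r s : ℕ} {g : (Fin r × Fin s → ℝ) → ℝ} {n : Fin r}
    (hd : ∀ κ x, DifferentiableAt ℝ (fun t => g (Function.update x (n, κ) t)) (x (n, κ)))
    (hc : ∀ κ, Continuous (mwPD (n, κ) g)) (a b : Fin r × Fin s → ℝ) (τ : Fin r → ℝ) (t : ℝ) :
    HasDerivAt (fun t => g (boxPoint a b (Function.update τ n t)))
      (∑ κ, mwPD (n, κ) g (boxPoint a b (Function.update τ n t)) * (b (n, κ) - a (n, κ))) t := by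
  let e : Fin s ↪ Fin r × Fin s := ⟨Prod.mk n, Prod.mk_right_injective n⟩
  have h := hasDerivAt_add_smul_sum_single (g := g) (b - a) (Finset.univ.map e)
    (by simpa [e] using hd) (by simpa [e] using hc) (boxPoint a b (Function.update τ n 0)) t
  have hline (t : ℝ) : boxPoint a b (Function.update τ n 0) +
      t • ∑ l ∈ Finset.univ.map e, Pi.single l ((b - a) l) =
        boxPoint a b (Function.update τ n t) := by
    ext ⟨m, κ⟩
    by_cases hm : m = n
    · subst hm
      simp [boxPoint, e, Pi.single_apply]
    · simp [boxPoint, e, hm]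
  simp only [hline] at h
  simpa [e] using h

/-- The multi-indices supported on `S`: those with the value `k₀` off `S`. -/
def multiIndicesOn {ι κ : Type*} [Fintype ι] [DecidableEq ι] [Fintype κ] (S : Finset ι) (k₀ : κ) :
    Finset (ι → κ) :=
  Fintype.piFinset fun m => if m ∈ S then Finset.univ else {k₀}

theorem mem_multiIndicesOn {ι κ : Type*} [Fintype ι] [DecidableEq ι] [Fintype κ] {S : Finset ι}
    {k₀ : κ} {k : ι → κ} : k ∈ multiIndicesOn S k₀ ↔ ∀ m, m ∉ S → k m = k₀ := by
  refine Fintype.mem_piFinset.trans (forall_congr' fun m => ?_)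
  by_cases h : m ∈ S <;> simp [h]

open Finset in
/-- Summing over the index at `n` and over the multi-indices supported on `S` amounts to summing
over the multi-indices supported on `insert n S`. -/
theorem sum_multiIndicesOn_update {ι κ β : Type*} [Fintype ι] [DecidableEq ι] [Fintype κ]
    [AddCommMonoid β] {S : Finset ι} {n : ι} (hn : n ∉ S) (k₀ : κ) (G : (ι → κ) → β) :
    ∑ k ∈ multiIndicesOn S k₀, ∑ j, G (Function.update k n j) =
      ∑ k ∈ multiIndicesOn (insert n S) k₀, G k := by
  rw [← sum_product']
  refine sum_nbij' (fun p => Function.update p.1 n p.2)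
    (fun k => (Function.update k n k₀, k n)) ?_ ?_ ?_ ?_ ?_
  · rintro ⟨k, j⟩ hk
    simp only [mem_product, mem_multiIndicesOn, mem_univ, and_true, mem_insert, not_or] at hk ⊢
    intro m hm
    simpa [hm.1] using hk m hm.2
  · intro k hk
    simp only [mem_product, mem_multiIndicesOn, mem_univ, and_true, mem_insert, not_or] at hk ⊢
    intro m hm
    by_cases h : m = n
    · simp [h]
    · simpa [h] using hk m ⟨h, hm⟩
  · rintro ⟨k, j⟩ hk
    simp only [mem_product, mem_multiIndicesOn, mem_univ, and_true] at hk
    simp [← hk n hn]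
  · intro k _
    simp
  · intro p _
    rfl

/-- mean value theorem for the multidimensional increment of a
`C^N`-function: there is `c ∈ P(a,b) = ∏_n [a_n,b_n]` (product of segments in `ℝ^K`)
with `□f(a,b) = ∑_{k ∈ K^N} ∂̃_k f(c) ∏_n (b_{n,k_n} − a_{n,k_n})`. -/
theorem stmt2 {r s : ℕ} (hr : 0 < r) (hs : 0 < s)
    (f : (Fin r × Fin s → ℝ) → ℝ) (hf : mwIsCNG f)
    (a b : Fin r × Fin s → ℝ) :
    ∃ c : Fin r × Fin s → ℝ,
      (∀ n : Fin r,
        (fun k => c (n, k)) ∈ segment ℝ (fun k => a (n, k)) (fun k => b (n, k))) ∧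
      mwBoxIncrG f a b =
        ∑ k : Fin r → Fin s,
          mwIterPD (((Finset.univ : Finset (Fin r)).sort (· ≤ ·)).map
            (fun m => (m, k m))) f c *
            ∏ n : Fin r, (b (n, k n) - a (n, k n)) := by
  let k₀ : Fin s := ⟨0, hs⟩
  let D (S : Finset (Fin r)) (k : Fin r → Fin s) : (Fin r × Fin s → ℝ) → ℝ :=
    mwIterPD ((S.sort (· ≤ ·)).map fun m => (m, k m)) f
  let F (S : Finset (Fin r)) (τ : Fin r → ℝ) : ℝ :=
    ∑ k ∈ multiIndicesOn S k₀,
      D S k (boxPoint a b τ) * ∏ m ∈ S, (b (m, k m) - a (m, k m))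
  have hF (n : Fin r) (S : Finset (Fin r)) (hn : ∀ m ∈ S, n < m) (τ : Fin r → ℝ) (t : ℝ) :
      HasDerivAt (fun t => F S (Function.update τ n t))
        (F (insert n S) (Function.update τ n t)) t := by
    have hnS : n ∉ S := fun h => lt_irrefl _ (hn n h)
    have hlist (k : Fin r → Fin s) (κ : Fin s) :
        ((insert n S).sort (· ≤ ·)).map (fun m => (m, Function.update k n κ m)) =
          (n, κ) :: (S.sort (· ≤ ·)).map fun m => (m, k m) := by
      rw [Finset.sort_insert (· ≤ ·) (fun m hm => (hn m hm).le) hnS, List.map_cons,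
        Function.update_self]
      congr 1
      refine List.map_congr_left fun m hm => ?_
      have : m ≠ n := fun h => hnS (h ▸ (Finset.mem_sort _).1 hm)
      rw [Function.update_of_ne this]
    have hD (k : Fin r → Fin s) (κ : Fin s) :
        D (insert n S) (Function.update k n κ) = mwPD (n, κ) (D S k) := by
      simp only [D, hlist]
      rfl
    have hterm (k : Fin r → Fin s) := hasDerivAt_boxPoint_update (g := D S k) (n := n)
      (fun κ => by
        have := (hf (insert n S) (Function.update k n κ)).1
        rw [hlist] at this
        exact this.2)
      (fun κ => hD k κ ▸ (hf (insert n S) (Function.update k n κ)).2) a b τ t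
    have hprod (k : Fin r → Fin s) (κ : Fin s) :
        ∏ m ∈ insert n S, (b (m, Function.update k n κ m) - a (m, Function.update k n κ m)) =
          (b (n, κ) - a (n, κ)) * ∏ m ∈ S, (b (m, k m) - a (m, k m)) := by
      rw [Finset.prod_insert hnS, Function.update_self]
      congr 1
      refine Finset.prod_congr rfl fun m hm => ?_
      have : m ≠ n := fun h => hnS (h ▸ hm)
      rw [Function.update_of_ne this]
    have hsum : HasDerivAt (fun t => F S (Function.update τ n t)) _ t :=
      HasDerivAt.fun_sum fun k _ =>
        (hterm k).mul_const (∏ m ∈ S, (b (m, k m) - a (m, k m)))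
    convert hsum using 1
    simp only [F]
    rw [← sum_multiIndicesOn_update hnS k₀]
    simp only [hD, hprod, Finset.sum_mul, mul_assoc]
  obtain ⟨θ, hθ, hmain⟩ := exists_sum_eq_of_hasDerivAt F hF Finset.univ
  refine ⟨boxPoint a b θ, fun n => ?_, ?_⟩
  · rw [segment_eq_image']
    exact ⟨θ n, hθ n, by ext k; simp [boxPoint]⟩
  · have hempty (τ : Fin r → ℝ) : F ∅ τ = f (boxPoint a b τ) := by
      have : multiIndicesOn (∅ : Finset (Fin r)) k₀ = {fun _ => k₀} := by
        ext k; simp [mem_multiIndicesOn, funext_iff]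
      simp [F, D, this, mwIterPD]
    have hbox : mwBoxIncrG f a b = ∑ M : Finset (Fin r),
        (-1 : ℝ) ^ M.card * F ∅ (fun n => if n ∈ M then 0 else 1) := by
      refine Finset.sum_congr rfl fun M _ => ?_
      rw [hempty]
      congr 2
      ext l
      by_cases h : l.1 ∈ M <;> simp [boxPoint, h]
    rw [hbox, hmain]
    have : multiIndicesOn (Finset.univ : Finset (Fin r)) k₀ = Finset.univ := by
      ext k; simp [mem_multiIndicesOn]
    simp [F, D, this]
end

section
/- Let f : V^N → ℝ be a C^N-function and let X ⊆ V^N be P-convex, i.e. P(a,b) = ∏_{n ∈ N}[a_n,b_n] ⊆ X for all a, b ∈ X, where [a_n,b_n] is the straight-line segment in ℝ^K joining a_n to b_n. Suppose that ∇_N f is bounded on X, i.e. there is C ≥ 0 with ‖∇_N f(x)‖ = (∑_{k ∈ K^N} (∂̃_k f(x))²)^{1/2} ≤ C for all x ∈ X. Then f is N-dimensional Lipschitz on X: |□f(a,b)| ≤ C ∏_{n ∈ N} ‖b_n − a_n‖ for all a, b ∈ X, where ‖·‖ is the Euclidean norm on ℝ^K. -/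
open MeasureTheory

lemma hasDerivAt_comp_update {ι : Type*} [DecidableEq ι] {h : (ι → ℝ) → ℝ} {l : ι}
    (hd : ∀ x, DifferentiableAt ℝ (fun t => h (Function.update x l t)) (x l))
    (x : ι → ℝ) (t : ℝ) :
    HasDerivAt (fun t => h (Function.update x l t)) (mwPD l h (Function.update x l t)) t := by
  have := (hd (Function.update x l t)).hasDerivAt
  simpa [mwPD] using this

/-- A function with continuous partial derivatives in the coordinates of `A` is differentiable
along lines whose direction is supported on `A`. -/
lemma hasDerivAt_line_zero {ι : Type*} [DecidableEq ι] {h : (ι → ℝ) → ℝ} (A : Finset ι)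
    (hd : ∀ l ∈ A, ∀ x, DifferentiableAt ℝ (fun t => h (Function.update x l t)) (x l))
    (hc : ∀ l ∈ A, Continuous (mwPD l h)) (v p : ι → ℝ) :
    HasDerivAt (fun t : ℝ => h (fun i => p i + if i ∈ A then t * v i else 0))
      (∑ l ∈ A, v l * mwPD l h p) 0 := by
  induction A using Finset.induction_on with
  | empty => simpa using hasDerivAt_const (0 : ℝ) (h p)
  | insert l A hl ih =>
    have ih := ih (fun j hj => hd j (Finset.mem_insert_of_mem hj))
      (fun j hj => hc j (Finset.mem_insert_of_mem hj))
    have hd := hd l (Finset.mem_insert_self l A)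
    have hc := hc l (Finset.mem_insert_self l A)
    rw [Finset.sum_insert hl]
    set q : ℝ → ι → ℝ := fun t i => p i + if i ∈ A then t * v i else 0 with hq
    have hq0 : q 0 = p := by ext i; simp [hq]
    have hql : ∀ t, q t l = p l := fun t => by simp [hq, hl]
    have hqc : Continuous q := by
      refine continuous_pi fun i => ?_
      by_cases hi : i ∈ A <;> simp only [hq, hi, if_true, if_false] <;> fun_prop
    have hmvt : ∀ t : ℝ, ∃ τ ∈ Set.Ioo (0 : ℝ) 1,
        h (Function.update (q t) l (p l + t * v l)) - h (q t) =
          t * (v l * mwPD l h (Function.update (q t) l (p l + τ * (t * v l)))) := by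
      intro t
      have hder : ∀ τ : ℝ, HasDerivAt
          (fun τ => h (Function.update (q t) l (p l + τ * (t * v l))))
          (mwPD l h (Function.update (q t) l (p l + τ * (t * v l))) * (t * v l)) τ := by
        intro τ
        have h2 : HasDerivAt (fun τ : ℝ => p l + τ * (t * v l)) (t * v l) τ := by
          simpa using ((hasDerivAt_id τ).mul_const (t * v l)).const_add (p l)
        exact (hasDerivAt_comp_update hd (q t) _).comp τ h2
      obtain ⟨τ, hτ, he⟩ := exists_hasDerivAt_eq_slope _ _ (zero_lt_one' ℝ)
        (fun τ _ => (hder τ).continuousAt.continuousWithinAt) (fun τ _ => hder τ)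
      refine ⟨τ, hτ, ?_⟩
      have h0 : Function.update (q t) l (p l) = q t := by
        rw [← hql t, Function.update_eq_self]
      simp only [zero_mul, one_mul, add_zero, h0, sub_zero, div_one] at he
      rw [← he]; ring
    choose τ hτ he using hmvt
    have hlim : Filter.Tendsto (fun t => p l + τ t * (t * v l)) (nhds 0) (nhds (p l)) := by
      have h1 : Filter.Tendsto (fun t : ℝ => τ t * (t * v l)) (nhds 0) (nhds 0) := by
        refine squeeze_zero_norm (a := fun t : ℝ => |t * v l|) (fun t => ?_) ?_
        · rw [Real.norm_eq_abs, abs_mul, abs_of_pos (hτ t).1]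
          exact mul_le_of_le_one_left (abs_nonneg _) (hτ t).2.le
        · have : Continuous fun t : ℝ => |t * v l| := by fun_prop
          simpa using this.tendsto 0
      simpa using h1.const_add (p l)
    have hstep : HasDerivAt (fun t => h (Function.update (q t) l (p l + t * v l)) - h (q t))
        (v l * mwPD l h p) 0 := by
      rw [hasDerivAt_iff_tendsto_slope_zero]
      have h1 : Filter.Tendsto (fun t => Function.update (q t) l (p l + τ t * (t * v l)))
          (nhds 0) (nhds p) := by
        have := (hqc.tendsto 0).update l hlim
        simpa [hq0] using this
      have h2 := ((hc.tendsto p).comp h1).const_mul (v l)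
      refine (h2.mono_left nhdsWithin_le_nhds).congr' ?_
      filter_upwards [self_mem_nhdsWithin] with t ht
      have ht : t ≠ 0 := ht
      rw [zero_add, he t, he 0]
      simp [ht]
    refine (hstep.add ih).congr_of_eventuallyEq (Filter.Eventually.of_forall fun t => ?_)
    have hupd : (fun i => p i + if i ∈ insert l A then t * v i else 0) =
        Function.update (q t) l (p l + t * v l) := by
      ext i
      by_cases hi : i = l
      · subst hi; simp
      · simp [hi, hq]
    beta_reduce
    rw [hupd]
    exact (sub_add_cancel _ (h (q t))).symm

lemma hasDerivAt_line {ι : Type*} [DecidableEq ι] {h : (ι → ℝ) → ℝ} {A : Finset ι}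
    (hd : ∀ l ∈ A, ∀ x, DifferentiableAt ℝ (fun t => h (Function.update x l t)) (x l))
    (hc : ∀ l ∈ A, Continuous (mwPD l h)) {v : ι → ℝ} (hv : ∀ i ∉ A, v i = 0)
    (p : ι → ℝ) (t : ℝ) :
    HasDerivAt (fun t : ℝ => h (p + t • v)) (∑ l ∈ A, v l * mwPD l h (p + t • v)) t := by
  have h1 := hasDerivAt_line_zero A hd hc v (p + t • v)
  have h2 : HasDerivAt (fun u : ℝ => u - t) 1 t := (hasDerivAt_id t).sub_const t
  have h3 := h1.comp_of_eq t h2 (sub_self t).symm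
  rw [mul_one] at h3
  refine h3.congr_of_eventuallyEq (Filter.Eventually.of_forall fun u => ?_)
  simp only [Function.comp_apply]
  congr 1
  ext i
  by_cases hi : i ∈ A
  · simp [hi]; ring
  · simp [hi, hv i hi]

/-- The multidimensional increment in the block coordinates belonging to `T`. -/
noncomputable def partialBoxIncr {r s : ℕ} (T : Finset (Fin r)) (g : (Fin r × Fin s → ℝ) → ℝ)
    (x y : Fin r × Fin s → ℝ) : ℝ :=
  ∑ M ∈ T.powerset, (-1 : ℝ) ^ M.card * g (fun l => if l.1 ∈ M then x l else y l)

lemma partialBoxIncr_insert {r s : ℕ} {T : Finset (Fin r)} {m : Fin r} (hm : m ∉ T)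
    (g : (Fin r × Fin s → ℝ) → ℝ) (x y : Fin r × Fin s → ℝ) :
    partialBoxIncr (insert m T) g x y = partialBoxIncr T g x y -
      partialBoxIncr T g x (fun l => if l.1 = m then x l else y l) := by
  unfold partialBoxIncr
  rw [Finset.sum_powerset_insert hm, sub_eq_add_neg, ← Finset.sum_neg_distrib]
  congr 1
  refine Finset.sum_congr rfl fun M hM => ?_
  have hmM : m ∉ M := fun h => hm (Finset.mem_powerset.1 hM h)
  rw [Finset.card_insert_of_notMem hmM, pow_succ, mul_neg_one, neg_mul]
  congr 4
  ext l
  by_cases h1 : l.1 = m <;> by_cases h2 : l.1 ∈ M <;> simp [h1, h2]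

/-- The iterated derivative of `f` in the blocks listed in `l`, contracted with the vectors
`d (n, ·)`, `n ∈ l`. The multi-index runs over all blocks; blocks outside `l` are averaged out. -/
noncomputable def contractedIterPD {r s : ℕ} (d : Fin r × Fin s → ℝ) (l : List (Fin r))
    (f : (Fin r × Fin s → ℝ) → ℝ) (x : Fin r × Fin s → ℝ) : ℝ :=
  ∑ k : Fin r → Fin s, (∏ n, if n ∈ l then d (n, k n) else (s : ℝ)⁻¹) *
    mwIterPD (l.map (fun n => (n, k n))) f x

lemma contractedIterPD_nil {r s : ℕ} (hs : 0 < s) (d : Fin r × Fin s → ℝ)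
    (f : (Fin r × Fin s → ℝ) → ℝ) : contractedIterPD d [] f = f := by
  ext x
  have hs : (s : ℝ) ≠ 0 := by exact_mod_cast hs.ne'
  simp [contractedIterPD, mwIterPD, hs]

lemma sum_pi_average {r s : ℕ} (hs : 0 < s) (m : Fin r) (F : Fin r → Fin s → ℝ)
    (hF : ∀ j, F m j = (s : ℝ)⁻¹) (e : Fin s → ℝ) (H : (Fin r → Fin s) → ℝ) :
    ∑ k : Fin r → Fin s, (∏ n, F n (k n)) * ∑ j, e j * H (Function.update k m j) =
      ∑ k : Fin r → Fin s, (∏ n, if n = m then e (k n) else F n (k n)) * H k := by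
  have hs : (s : ℝ) ≠ 0 := by exact_mod_cast hs.ne'
  rw [← (Equiv.funSplitAt m (Fin s)).symm.sum_comp, ← (Equiv.funSplitAt m (Fin s)).symm.sum_comp,
    Fintype.sum_prod_type_right, Fintype.sum_prod_type_right]
  refine Finset.sum_congr rfl fun k _ => ?_
  have hu : ∀ i j, Function.update ((Equiv.funSplitAt m (Fin s)).symm (i, k)) m j =
      (Equiv.funSplitAt m (Fin s)).symm (j, k) := by
    intro i j
    ext n
    by_cases hn : n = m
    · subst hn; simp
    · simp [hn]
  have hsub : ∀ n : {n // n ≠ m}, n.1 ≠ m := fun n => n.2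
  simp only [hu, Fintype.prod_eq_mul_prod_subtype_ne _ m, hF,
    Equiv.funSplitAt_symm_apply, hsub, if_true, if_false, dif_pos, dif_neg,
    not_false_eq_true, Finset.mul_sum, Finset.sum_const, Finset.card_univ, Fintype.card_fin,
    nsmul_eq_mul]
  refine Finset.sum_congr rfl fun j _ => ?_
  field_simp

lemma hasDerivAt_contractedIterPD {r s : ℕ} (hs : 0 < s) {f : (Fin r × Fin s → ℝ) → ℝ}
    (hf : mwIsCNG f) (d : Fin r × Fin s → ℝ) {m : Fin r} {l : List (Fin r)}
    (hl : (m :: l).Pairwise (· < ·)) (p : Fin r × Fin s → ℝ) (t : ℝ) :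
    HasDerivAt
      (fun t : ℝ => contractedIterPD d l f (p + t • fun i => if i.1 = m then d i else 0))
      (contractedIterPD d (m :: l) f (p + t • fun i => if i.1 = m then d i else 0)) t := by
  have hml : m ∉ l := fun h => lt_irrefl _ ((List.pairwise_cons.1 hl).1 m h)
  have hsort : (m :: l).toFinset.sort (· ≤ ·) = m :: l :=
    (List.toFinset_sort (· ≤ ·) (hl.imp ne_of_lt)).2 (hl.imp le_of_lt)
  have hupd : ∀ (k : Fin r → Fin s) (j : Fin s),
      l.map (fun n => (n, Function.update k m j n)) = l.map (fun n => (n, k n)) := by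
    intro k j
    refine List.map_congr_left fun n hn => ?_
    rw [Function.update_of_ne (by rintro rfl; exact hml hn)]
  have hreg : ∀ (k : Fin r → Fin s) (j : Fin s),
      (∀ x, DifferentiableAt ℝ (fun t => mwIterPD (l.map (fun n => (n, k n))) f
        (Function.update x (m, j) t)) (x (m, j))) ∧
      Continuous (mwPD (m, j) (mwIterPD (l.map (fun n => (n, k n))) f)) := by
    intro k j
    have := hf (m :: l).toFinset (Function.update k m j)
    rw [hsort, List.map_cons, hupd, Function.update_self] at this
    exact ⟨this.1.2, this.2⟩
  set v : Fin r × Fin s → ℝ := fun i => if i.1 = m then d i else 0 with hv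
  have hterm : ∀ k : Fin r → Fin s, HasDerivAt
      (fun t : ℝ => mwIterPD (l.map (fun n => (n, k n))) f (p + t • v))
      (∑ j, d (m, j) * mwIterPD ((m :: l).map (fun n => (n, Function.update k m j n))) f
        (p + t • v)) t := by
    intro k
    have h := hasDerivAt_line (h := mwIterPD (l.map (fun n => (n, k n))) f)
      (A := Finset.univ.map (Function.Embedding.sectR m (Fin s))) (v := v)
      (by simpa using fun j => (hreg k j).1) (by simpa using fun j => (hreg k j).2)
      (by
        rintro ⟨n, j⟩ hi
        simp only [hv, ite_eq_right_iff]
        rintro rfl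
        simp at hi) p t
    simpa [hv, hupd, mwIterPD] using h
  have hsum := HasDerivAt.fun_sum (u := Finset.univ) fun k _ =>
    (hterm k).const_mul (∏ n, if n ∈ l then d (n, k n) else (s : ℝ)⁻¹)
  have havg := sum_pi_average hs m (fun n j => if n ∈ l then d (n, j) else (s : ℝ)⁻¹)
    (by simp [hml]) (fun j => d (m, j))
    (fun k => mwIterPD ((m :: l).map (fun n => (n, k n))) f (p + t • v))
  rw [havg] at hsum
  refine hsum.congr_deriv (Finset.sum_congr rfl fun k _ => ?_)
  congr 1
  refine Finset.prod_congr rfl fun n _ => ?_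
  by_cases hn : n = m
  · subst hn; simp
  · simp [hn]

/-- Mean value theorem for multidimensional increments, one block at a time. -/
lemma exists_mwBoxIncrG_eq_partialBoxIncr {r s : ℕ} (hs : 0 < s) {f : (Fin r × Fin s → ℝ) → ℝ}
    (hf : mwIsCNG f) (a b : Fin r × Fin s → ℝ) (l : List (Fin r))
    (hl : l.Pairwise (· < ·)) :
    ∃ c : Fin r × Fin s → ℝ,
      (∀ n, (fun k => c (n, k)) ∈ segment ℝ (fun k => a (n, k)) (fun k => b (n, k))) ∧
      (∀ i : Fin r × Fin s, i.1 ∉ l → c i = b i) ∧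
      mwBoxIncrG f a b =
        partialBoxIncr (Finset.univ \ l.toFinset) (contractedIterPD (b - a) l f) a c := by
  induction l with
  | nil =>
    exact ⟨b, fun n => right_mem_segment _ _ _, fun _ _ => rfl, by
      simp [mwBoxIncrG, partialBoxIncr, contractedIterPD_nil hs]⟩
  | cons m l ih =>
    obtain ⟨c, hc, hcb, he⟩ := ih (List.pairwise_cons.1 hl).2
    have hml : m ∉ l := fun h => lt_irrefl _ ((List.pairwise_cons.1 hl).1 m h)
    set T := Finset.univ \ (m :: l).toFinset with hT
    have hmT : m ∉ T := by simp [hT]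
    have hins : Finset.univ \ l.toFinset = insert m T := by
      ext n
      by_cases hn : n = m
      · subst hn; simp [hml]
      · simp [hT, hn]
    rw [hins, partialBoxIncr_insert hmT] at he
    set v : Fin r × Fin s → ℝ := fun i => if i.1 = m then (b - a) i else 0 with hv
    set c₀ : Fin r × Fin s → ℝ := fun i => if i.1 = m then a i else c i with hc₀
    have hpt : ∀ (M : Finset (Fin r)), m ∉ M → ∀ t : ℝ,
        (fun i : Fin r × Fin s => if i.1 ∈ M then a i else (c₀ + t • v) i) =
          (fun i => if i.1 ∈ M then a i else c₀ i) + t • v := by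
      intro M hM t
      ext i
      by_cases hi : i.1 ∈ M
      · have : i.1 ≠ m := fun h => hM (h ▸ hi)
        simp [hi, hv, this]
      · simp [hi]
    have hder : ∀ t : ℝ, HasDerivAt
        (fun t : ℝ => partialBoxIncr T (contractedIterPD (b - a) l f) a (c₀ + t • v))
        (partialBoxIncr T (contractedIterPD (b - a) (m :: l) f) a (c₀ + t • v)) t := by
      intro t
      refine HasDerivAt.fun_sum fun M hM => HasDerivAt.const_mul _ ?_
      have hM : m ∉ M := fun h => hmT (Finset.mem_powerset.1 hM h)
      simp only [hpt M hM]
      exact hasDerivAt_contractedIterPD hs hf (b - a) hl _ t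
    obtain ⟨t, ht, hslope⟩ := exists_hasDerivAt_eq_slope _ _ (zero_lt_one' ℝ)
      (fun t _ => (hder t).continuousAt.continuousWithinAt) (fun t _ => hder t)
    have hc1 : c₀ + (1 : ℝ) • v = c := by
      ext i
      by_cases hi : i.1 = m
      · have : i.1 ∉ l := hi ▸ hml
        simp [hc₀, hv, hi, hcb i this]
      · simp [hc₀, hv, hi]
    rw [hc1, zero_smul, add_zero, sub_zero, div_one, ← he] at hslope
    refine ⟨c₀ + t • v, fun n => ?_, fun i hi => ?_, hslope.symm⟩
    · by_cases hn : n = m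
      · rw [segment_eq_image']
        refine ⟨t, ⟨ht.1.le, ht.2.le⟩, ?_⟩
        ext k
        simp [hc₀, hv, hn]
      · simpa [hc₀, hv, hn] using hc n
    · simp only [List.mem_cons, not_or] at hi
      simp [hc₀, hv, hi.1, hcb i hi.2]

/-- a `C^N`-function whose `N`-gradient is bounded by `C` on a
`P`-convex set `X` is `N`-dimensional Lipschitz on `X`. -/
theorem stmt3 {r s : ℕ} (hr : 0 < r) (hs : 0 < s)
    (f : (Fin r × Fin s → ℝ) → ℝ) (hf : mwIsCNG f)
    (X : Set (Fin r × Fin s → ℝ))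
    (hX : ∀ a ∈ X, ∀ b ∈ X, ∀ c : Fin r × Fin s → ℝ,
      (∀ n : Fin r,
        (fun k => c (n, k)) ∈ segment ℝ (fun k => a (n, k)) (fun k => b (n, k))) →
      c ∈ X)
    (C : ℝ) (hC : 0 ≤ C)
    (hbd : ∀ x ∈ X,
      Real.sqrt (∑ k : Fin r → Fin s,
        mwIterPD (((Finset.univ : Finset (Fin r)).sort (· ≤ ·)).map
          (fun m => (m, k m))) f x ^ 2) ≤ C) :
    ∀ a ∈ X, ∀ b ∈ X,
      |mwBoxIncrG f a b| ≤
        C * ∏ n : Fin r, Real.sqrt (∑ k : Fin s, (b (n, k) - a (n, k)) ^ 2) := by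
  intro a ha b hb
  obtain ⟨c, hc, -, he⟩ := exists_mwBoxIncrG_eq_partialBoxIncr hs hf a b
    ((Finset.univ : Finset (Fin r)).sort (· ≤ ·)) (Finset.sortedLT_sort _).pairwise
  have he : mwBoxIncrG f a b = ∑ k : Fin r → Fin s, (∏ n, (b - a) (n, k n)) *
      mwIterPD (((Finset.univ : Finset (Fin r)).sort (· ≤ ·)).map (fun m => (m, k m))) f c := by
    rw [he]
    simp [partialBoxIncr, contractedIterPD]
  have hprod : ∏ n : Fin r, Real.sqrt (∑ k : Fin s, (b (n, k) - a (n, k)) ^ 2) =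
      Real.sqrt (∑ k : Fin r → Fin s, (∏ n, (b - a) (n, k n)) ^ 2) := by
    rw [← Real.sqrt_prod _ fun n _ => Finset.sum_nonneg fun k _ => sq_nonneg _,
      Finset.prod_univ_sum, Fintype.piFinset_univ]
    simp [Finset.prod_pow]
  rw [he, hprod]
  refine (abs_le_of_sq_le_sq' ?_ (by positivity) |> abs_le.2).trans
    (mul_le_mul_of_nonneg_right (hbd c (hX a ha b hb c hc)) (Real.sqrt_nonneg _))
  rw [mul_pow, Real.sq_sqrt (Finset.sum_nonneg fun _ _ => sq_nonneg _),
    Real.sq_sqrt (Finset.sum_nonneg fun _ _ => sq_nonneg _), mul_comm]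
  exact Finset.sum_mul_sq_le_sq_mul_sq _ _ _
end

section
/- Let f : ℝ^N → ℝ be a C^N-function and let a, b ∈ ℝ^N with a_n ≤ b_n for every n ∈ N. Then ∫_{P(a,b)} ∂_N f dμ = □f(a,b), where P(a,b) = ∏_{n ∈ N}[a_n,b_n] and μ is Lebesgue measure on ℝ^N. -/
open MeasureTheory

theorem mwIterPD_map_succ {r : ℕ} (ls : List (Fin r)) (f : (Fin (r + 1) → ℝ) → ℝ) (t : ℝ)
    (x : Fin r → ℝ) :
    mwIterPD (ls.map Fin.succ) f (Fin.cons t x : Fin (r + 1) → ℝ) =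
      mwIterPD ls (fun y => f (Fin.cons t y : Fin (r + 1) → ℝ)) x := by
  induction ls generalizing x with
  | nil => rfl
  | cons l ls ih =>
    change deriv (fun s => mwIterPD (ls.map Fin.succ) f _) _ = deriv (fun s => mwIterPD ls _ _) _
    simp only [← Fin.cons_update, ih, Fin.cons_succ]

theorem mwExistsIterPD.cons_of_map_succ {r : ℕ} {ls : List (Fin r)} {f : (Fin (r + 1) → ℝ) → ℝ}
    (h : mwExistsIterPD (ls.map Fin.succ) f) (t : ℝ) :
    mwExistsIterPD ls (fun y => f (Fin.cons t y : Fin (r + 1) → ℝ)) := by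
  induction ls with
  | nil => trivial
  | cons l ls ih =>
    refine ⟨ih h.1, fun x => ?_⟩
    simpa only [← Fin.cons_update, mwIterPD_map_succ, Fin.cons_succ] using
      h.2 (Fin.cons t x : Fin (r + 1) → ℝ)

theorem sum_finset_fin_succ {M : Type*} [AddCommMonoid M] {r : ℕ}
    (g : Finset (Fin (r + 1)) → M) :
    ∑ s, g s = ∑ s : Finset (Fin r), g (s.map (Fin.succEmb r)) +
      ∑ s : Finset (Fin r), g (insert 0 (s.map (Fin.succEmb r))) := by
  have key : ∀ g : Finset (Fin (r + 1)) → M,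
      ∑ s ∈ (Finset.univ.map (Fin.succEmb r)).powerset, g s =
        ∑ s : Finset (Fin r), g (s.map (Fin.succEmb r)) := fun g => by
    refine (Finset.sum_bij (fun s _ => s.map (Fin.succEmb r)) ?_ ?_ ?_ ?_).symm
    · intro s _
      exact Finset.mem_powerset.2 (Finset.map_subset_map.2 (Finset.subset_univ s))
    · intro s _ s' _ h
      exact Finset.map_injective _ h
    · intro s hs
      obtain ⟨u, -, rfl⟩ := Finset.subset_map_iff.1 (Finset.mem_powerset.1 hs)
      exact ⟨u, Finset.mem_univ _, rfl⟩
    · intro s _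
      rfl
  have h0 : (0 : Fin (r + 1)) ∉ Finset.univ.map (Fin.succEmb r) := by simp
  have hu : (Finset.univ : Finset (Finset (Fin (r + 1)))) =
      (insert 0 (Finset.univ.map (Fin.succEmb r))).powerset := by
    rw [← Finset.powerset_univ, Fin.univ_succ, Finset.cons_eq_insert]
    rfl
  rw [hu, Finset.sum_powerset_insert h0, key, key fun s => g (insert 0 s)]

theorem mwBoxIncr_succ {r : ℕ} {α : Type*} (f : (Fin (r + 1) → α) → ℝ) (x y : Fin (r + 1) → α) :
    mwBoxIncr f x y =
      mwBoxIncr (fun z => f (Fin.cons (y 0) z : Fin (r + 1) → α)) (Fin.tail x) (Fin.tail y) -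
      mwBoxIncr (fun z => f (Fin.cons (x 0) z : Fin (r + 1) → α)) (Fin.tail x) (Fin.tail y) := by
  unfold mwBoxIncr
  rw [sum_finset_fin_succ, sub_eq_add_neg, ← Finset.sum_neg_distrib]
  congr 1 <;> refine Finset.sum_congr rfl fun s _ => ?_
  · rw [Finset.card_map]
    congr 2
    ext n
    refine Fin.cases ?_ (fun i => ?_) n <;> simp [Fin.tail]
  · rw [Finset.card_insert_of_notMem (by simp), Finset.card_map, pow_succ, mul_neg_one, neg_mul]
    congr 3
    ext n
    refine Fin.cases ?_ (fun i => ?_) n <;> simp [Fin.tail]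

theorem setIntegral_Icc_fin_succ {r : ℕ} {F : (Fin (r + 1) → ℝ) → ℝ} (hF : Continuous F)
    (a b : Fin (r + 1) → ℝ) :
    ∫ x in Set.Icc a b, F x = ∫ y in Set.Icc (Fin.tail a) (Fin.tail b),
      ∫ t in Set.Icc (a 0) (b 0), F (Fin.cons t y : Fin (r + 1) → ℝ) := by
  have hm := (volume_preserving_piFinSuccAbove (fun _ : Fin (r + 1) => ℝ) 0).symm
  have hcons : ∀ p, (MeasurableEquiv.piFinSuccAbove (fun _ : Fin (r + 1) => ℝ) 0).symm p =
      Fin.cons p.1 p.2 := fun p => by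
    simp only [MeasurableEquiv.piFinSuccAbove, Fin.insertNthEquiv_zero]
    rfl
  have hpre : (MeasurableEquiv.piFinSuccAbove (fun _ : Fin (r + 1) => ℝ) 0).symm ⁻¹' Set.Icc a b =
      Set.Icc (a 0) (b 0) ×ˢ Set.Icc (Fin.tail a) (Fin.tail b) := by
    ext p
    rw [Set.mem_preimage, hcons]
    simp only [Set.mem_Icc, Pi.le_def, Fin.forall_fin_succ, Fin.cons_zero, Fin.cons_succ,
      Set.mem_prod, Fin.tail]
    tauto
  have hcont : Continuous fun p : ℝ × (Fin r → ℝ) => F (Fin.cons p.1 p.2 : Fin (r + 1) → ℝ) := by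
    fun_prop
  rw [← hm.setIntegral_preimage_emb (MeasurableEquiv.measurableEmbedding _), hpre]
  simp only [hcons]
  rw [Measure.volume_eq_prod, ← Measure.prod_restrict, integral_prod_symm]
  rw [Measure.prod_restrict, ← Measure.volume_eq_prod]
  exact hcont.continuousOn.integrableOn_compact (isCompact_Icc.prod isCompact_Icc)

theorem setIntegral_mwDN {r : ℕ} {f : (Fin r → ℝ) → ℝ}
    (hf : ∀ ls, ls <:+ List.finRange r → mwExistsIterPD ls f ∧ Continuous (mwIterPD ls f))
    (a b : Fin r → ℝ) (hab : ∀ n, a n ≤ b n) :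
    ∫ x in Set.Icc a b, mwDN f x = mwBoxIncr f a b := by
  simp only [mwDN, Fin.sort_univ]
  induction r with
  | zero =>
    rw [volume_pi, Measure.pi_of_empty _ a]
    simp [mwBoxIncr, mwIterPD, Subsingleton.elim a b, Subsingleton.elim default (∅ : Finset (Fin 0))]
  | succ r ih =>
    have hslice : ∀ t ls, ls <:+ List.finRange r →
        mwExistsIterPD ls (fun y => f (Fin.cons t y : Fin (r + 1) → ℝ)) ∧
          Continuous (mwIterPD ls fun y => f (Fin.cons t y : Fin (r + 1) → ℝ)) := by
      intro t ls hls
      have h := hf (ls.map Fin.succ)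
        (by rw [List.finRange_succ]; exact (hls.map _).trans (List.suffix_cons _ _))
      refine ⟨h.1.cons_of_map_succ t, ?_⟩
      simp only [funext fun x => (mwIterPD_map_succ ls f t x).symm]
      exact h.2.comp (by fun_prop)
    have hD := hf _ List.suffix_rfl
    rw [setIntegral_Icc_fin_succ hD.2, mwBoxIncr_succ,
      ← ih (hslice _) (Fin.tail a) (Fin.tail b) fun n => hab n.succ,
      ← ih (hslice _) (Fin.tail a) (Fin.tail b) fun n => hab n.succ,
      ← integral_sub]
    · refine setIntegral_congr_fun measurableSet_Icc fun y _ => ?_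
      simp only [← mwIterPD_map_succ]
      rw [List.finRange_succ] at hD ⊢
      set G := mwIterPD ((List.finRange r).map Fin.succ) f
      have hderiv : ∀ t, HasDerivAt (fun t => G (Fin.cons t y : Fin (r + 1) → ℝ))
          (mwIterPD (0 :: (List.finRange r).map Fin.succ) f (Fin.cons t y : Fin (r + 1) → ℝ)) t := by
        intro t
        have : HasDerivAt (fun s => G (Function.update (Fin.cons t y : Fin (r + 1) → ℝ) 0 s))
            (mwIterPD (0 :: (List.finRange r).map Fin.succ) f (Fin.cons t y : Fin (r + 1) → ℝ)) t :=
          (hD.1.2 (Fin.cons t y)).hasDerivAt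
        simpa only [Fin.update_cons_zero] using this
      rw [integral_Icc_eq_integral_Ioc, ← intervalIntegral.integral_of_le (hab 0)]
      refine intervalIntegral.integral_eq_sub_of_hasDerivAt (fun t _ => hderiv t) ?_
      exact (hD.2.comp (by fun_prop)).intervalIntegrable _ _
    all_goals
      exact (hslice _ _ List.suffix_rfl).2.continuousOn.integrableOn_compact isCompact_Icc

/-- fundamental-theorem-of-calculus-type identity:
`∫_{P(a,b)} ∂_N f dμ = □f(a,b)` for a `C^N`-function `f` and `a ≤ b`. -/
theorem stmt4 {r : ℕ} (hr : 0 < r) (f : (Fin r → ℝ) → ℝ) (hf : mwIsCN f)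
    (a b : Fin r → ℝ) (hab : ∀ n, a n ≤ b n) :
    ∫ x in Set.Icc a b, mwDN f x = mwBoxIncr f a b := by
  refine setIntegral_mwDN (fun ls hls => ?_) a b hab
  have hp := List.pairwise_lt_finRange r
  have hls' := hp.sublist hls.sublist
  have := hf ls.toFinset
  rwa [(List.toFinset_sort (r := (· ≤ ·)) (hls'.imp ne_of_lt)).2 (hls'.imp le_of_lt)] at this
end

section
/- Let N be a finite set, let α be a type with a distinguished point 0 (and 0 also denotes the constant map n ↦ 0 in N → α), let I be a countable set, and for each i ∈ I let γ^i : (N → α) → (N → α) act coordinatewise, i.e. γ^i(x)(n) = γ^i_n(x(n)) for some maps γ^i_n : α → α. For a multi-index i = (i_1,…,i_p) ∈ I^p write γ^i = γ^{i_1} ∘ ⋯ ∘ γ^{i_p}. Let f : (N → α) → ℝ and p ≥ 1. Define 𝕄^0 f = f and 𝕄^{k+1} f(x) = ∑_{i ∈ I} □(𝕄^k f)(γ^i(0), γ^i(x)). Assume that for every k ∈ {0,…,p−1} and every x the family (□(𝕄^k f)(γ^i(0), γ^i(x)))_{i ∈ I} is absolutely summable, and that for every x the family (□f(γ^i(0),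 γ^i(x)))_{i ∈ I^p} is absolutely summable. Then 𝕄^p f(x) = ∑_{i ∈ I^p} □f(γ^i(0), γ^i(x)) for every x. -/
open MeasureTheory

/-- Summing the increments of `F` from a fixed corner `c` against the signs of `□` keeps only
the term in which no coordinate is taken from `c`. -/
theorem mwBoxIncr_mwBoxIncr {N α β : Type*} [Fintype N] [DecidableEq N]
    (F : (N → β) → ℝ) (c : N → β) (φ : (N → α) → N → β) (φc : N → α → β)
    (hφ : ∀ x n, φ x n = φc n (x n)) (a b : N → α) :
    mwBoxIncr (fun y => mwBoxIncr F c (φ y)) a b = mwBoxIncr F (φ a) (φ b) := by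
  unfold mwBoxIncr
  simp_rw [Finset.mul_sum]
  rw [Finset.sum_comm, Finset.sum_eq_single (∅ : Finset N)]
  · refine Finset.sum_congr rfl fun M _ => ?_
    simp only [Finset.card_empty, pow_zero, one_mul, Finset.notMem_empty, if_false]
    congr 2
    funext n
    simp only [hφ]
    split_ifs <;> rfl
  · intro L _ hL
    obtain ⟨n, hn⟩ := Finset.nonempty_iff_ne_empty.mpr hL
    rw [← Finset.powerset_univ, ← Finset.insert_erase (Finset.mem_univ n),
      Finset.sum_powerset_insert (Finset.notMem_erase n _), ← Finset.sum_add_distrib]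
    refine Finset.sum_eq_zero fun M hM => ?_
    have hnM : n ∉ M := fun h => Finset.notMem_erase n _ (Finset.mem_powerset.mp hM h)
    have hpt : (fun m => if m ∈ L then c m else φ (fun k => if k ∈ insert n M then a k else b k) m)
        = fun m => if m ∈ L then c m else φ (fun k => if k ∈ M then a k else b k) m := by
      funext m
      by_cases hm : m ∈ L
      · simp [hm]
      · have hmn : m ≠ n := fun h => hm (h ▸ hn)
        simp [hm, hφ, hmn]
    rw [hpt, Finset.card_insert_of_notMem hnM]
    ring
  · simp

theorem mwBoxIncr_tsum {N α I : Type*} [Fintype N] [DecidableEq N]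
    (g : I → (N → α) → ℝ) (hg : ∀ x, Summable fun i => g i x) (a b : N → α) :
    mwBoxIncr (fun x => ∑' i, g i x) a b = ∑' i, mwBoxIncr (g i) a b := by
  unfold mwBoxIncr
  rw [Summable.tsum_finsetSum fun M _ => (hg _).mul_left _]
  simp_rw [tsum_mul_left]

theorem mwComp_snoc {I β : Type*} (γ : I → β → β) {k : ℕ} (i : Fin k → I) (j : I) (x : β) :
    mwComp γ (Fin.snoc i j : Fin (k + 1) → I) x = mwComp γ i (γ j x) := by
  have key : ∀ (l : List I) (g : β → β),
      l.foldr (fun j g => γ j ∘ g) g = l.foldr (fun j g => γ j ∘ g) id ∘ g := by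
    intro l g
    induction l with
    | nil => rfl
    | cons a l ih => simp only [List.foldr_cons, ih, Function.comp_assoc]
  unfold mwComp
  rw [List.ofFn_succ']
  simp only [Fin.snoc_castSucc, Fin.snoc_last, List.concat_eq_append, List.foldr_append,
    List.foldr_cons, List.foldr_nil]
  rw [key]
  rfl

theorem mwBoxIncr_mwMWiter_succ {N α I : Type*} [Fintype N] [DecidableEq N] [Zero α]
    (γc : I → N → α → α) (γ : I → (N → α) → (N → α))
    (hγ : ∀ i x n, γ i x n = γc i n (x n)) (f : (N → α) → ℝ) (k : ℕ)
    (h : ∀ x, Summable fun i : I => mwBoxIncr (mwMWiter γ f k) (γ i 0) (γ i x))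
    (a b : N → α) :
    mwBoxIncr (mwMWiter γ f (k + 1)) a b =
      ∑' i, mwBoxIncr (mwMWiter γ f k) (γ i a) (γ i b) := by
  refine (mwBoxIncr_tsum (fun i x => mwBoxIncr (mwMWiter γ f k) (γ i 0) (γ i x)) h a b).trans ?_
  exact tsum_congr fun i => mwBoxIncr_mwBoxIncr _ _ (γ i) (γc i) (hγ i) a b

/-- A sum over multi-indices is computed by summing over the last index outermost. -/
theorem tsum_mwComp_succ {N α I : Type*} [Fintype N] [DecidableEq N]
    (γ : I → (N → α) → (N → α)) (f : (N → α) → ℝ) (k : ℕ) (a b : N → α)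
    (h : Summable fun i : Fin (k + 1) → I => mwBoxIncr f (mwComp γ i a) (mwComp γ i b)) :
    (∀ j, Summable fun i : Fin k → I =>
        mwBoxIncr f (mwComp γ i (γ j a)) (mwComp γ i (γ j b))) ∧
      ∑' i : Fin (k + 1) → I, mwBoxIncr f (mwComp γ i a) (mwComp γ i b) =
        ∑' j, ∑' i : Fin k → I, mwBoxIncr f (mwComp γ i (γ j a)) (mwComp γ i (γ j b)) := by
  let e : I × (Fin k → I) ≃ (Fin (k + 1) → I) := Fin.snocEquiv fun _ => I
  have he : ∀ q : I × (Fin k → I),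
      mwBoxIncr f (mwComp γ (e q) a) (mwComp γ (e q) b) =
        mwBoxIncr f (mwComp γ q.2 (γ q.1 a)) (mwComp γ q.2 (γ q.1 b)) := fun q => by
    rw [← mwComp_snoc, ← mwComp_snoc]
    rfl
  have hs := e.summable_iff.mpr h
  simp only [Function.comp_def, he] at hs
  refine ⟨fun j => hs.prod_factor j, ?_⟩
  rw [← e.tsum_eq]
  simp only [he]
  exact hs.tsum_prod

theorem mwBoxIncr_mwMWiter {N α I : Type*} [Fintype N] [DecidableEq N] [Zero α]
    (γc : I → N → α → α) (γ : I → (N → α) → (N → α))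
    (hγ : ∀ i x n, γ i x n = γc i n (x n)) (f : (N → α) → ℝ) (k : ℕ)
    (h : ∀ l < k, ∀ x, Summable fun i : I => mwBoxIncr (mwMWiter γ f l) (γ i 0) (γ i x))
    (a b : N → α)
    (hab : Summable fun i : Fin k → I => mwBoxIncr f (mwComp γ i a) (mwComp γ i b)) :
    mwBoxIncr (mwMWiter γ f k) a b =
      ∑' i : Fin k → I, mwBoxIncr f (mwComp γ i a) (mwComp γ i b) := by
  induction k generalizing a b with
  | zero => simp [mwMWiter, mwComp]
  | succ k ih =>
    obtain ⟨hj, hsum⟩ := tsum_mwComp_succ γ f k a b hab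
    rw [hsum, mwBoxIncr_mwMWiter_succ γc γ hγ f k (h k k.lt_succ_self)]
    exact tsum_congr fun j => ih (fun l hl => h l (hl.trans k.lt_succ_self)) _ _ (hj j)

/-- for coordinatewise-acting maps `γ^i`, the `p`-th iterate of the
MW-operator is given by `𝕄^p f(x) = ∑_{i ∈ I^p} □f(γ^i(0), γ^i(x))`. -/
theorem stmt5 {N α I : Type*} [Fintype N] [DecidableEq N] [Zero α] [Countable I]
    (γc : I → N → α → α)
    (γ : I → (N → α) → (N → α))
    (hγ : ∀ i x n, γ i x n = γc i n (x n))
    (f : (N → α) → ℝ) (p : ℕ) (hp : 1 ≤ p)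
    (h1 : ∀ k < p, ∀ x : N → α,
      Summable (fun i : I => |mwBoxIncr (mwMWiter γ f k) (γ i 0) (γ i x)|))
    (h2 : ∀ x : N → α,
      Summable (fun i : Fin p → I => |mwBoxIncr f (mwComp γ i 0) (mwComp γ i x)|)) :
    ∀ x : N → α, mwMWiter γ f p x =
      ∑' i : Fin p → I, mwBoxIncr f (mwComp γ i 0) (mwComp γ i x) := by
  intro x
  obtain ⟨k, rfl⟩ : ∃ k, p = k + 1 := ⟨p - 1, by omega⟩
  obtain ⟨hj, hsum⟩ := tsum_mwComp_succ γ f k 0 x (h2 x).of_abs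
  rw [hsum]
  exact tsum_congr fun j => mwBoxIncr_mwMWiter γc γ hγ f k
    (fun l hl y => (h1 l (hl.trans k.lt_succ_self) y).of_abs) _ _ (hj j)
end

section
/- Assume hypotheses H1 and H2. Then ∑_{i ∈ I} β^i = 1, where β^i = ∏_{n ∈ N} α^i_n. -/
open MeasureTheory

/-- A diagonal affine map scales Lebesgue measure by the product of its slopes. -/
theorem volume_image_diagonal_affine {ι : Type*} [Fintype ι] [DecidableEq ι] (α a : ι → ℝ)
    (g : (ι → ℝ) → ι → ℝ) (hg : ∀ x n, g x n = α n * x n + a n) (S : Set (ι → ℝ)) :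
    volume (g '' S) = ENNReal.ofReal |∏ n, α n| * volume S := by
  have hcomp : g = (fun x => x + a) ∘ Matrix.toLin' (Matrix.diagonal α) := by
    ext x n
    simp [hg, Matrix.mulVec_diagonal]
  rw [hcomp, Set.image_comp, Set.image_add_right, measure_preimage_add_right,
    Measure.addHaar_image_linearMap, LinearMap.det_toLin', Matrix.det_diagonal]

/-- under (H1) and (H2), `∑_{i ∈ I} β^i = 1` where `β^i = ∏_n α^i_n`. -/
theorem stmt6 {r : ℕ} (hr : 0 < r) {I : Type*} [Countable I] [Nontrivial I]
    (α a : I → Fin r → ℝ) (q : ℝ)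
    (hα : ∀ i n, 0 < α i n ∧ α i n < 1)
    (hqb : ∀ i n, α i n ≤ q) (hq1 : q < 1)
    (γ : I → (Fin r → ℝ) → (Fin r → ℝ))
    (hγ : ∀ i x n, γ i x n = α i n * x n + a i n)
    (T : Set (Fin r → ℝ)) (hTc : IsCompact T)
    (hT0 : (0 : Fin r → ℝ) ∈ T)
    (hTadm : ∀ x ∈ T, ∀ i, mwPi (γ i 0) (γ i x) ⊆ T)
    (hTpos : 0 < volume T)
    (hdisj : ∀ i j : I, i ≠ j → volume (γ i '' T ∩ γ j '' T) = 0)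
    (hsymm : volume (symmDiff T (⋃ i, γ i '' T)) = 0)
    (hclos : T = closure (⋃ i, γ i '' T)) :
    HasSum (fun i : I => ∏ n, α i n) 1 := by
  have hβ : ∀ i, 0 ≤ ∏ n, α i n := fun i => Finset.prod_nonneg fun n _ => (hα i n).1.le
  have hvol : ∀ i, volume (γ i '' T) = ENNReal.ofReal (∏ n, α i n) * volume T := fun i => by
    rw [volume_image_diagonal_affine (α i) (a i) (γ i) (hγ i), abs_of_nonneg (hβ i)]
  have hcont : ∀ i, Continuous (γ i) := fun i => by
    refine continuous_pi fun n => ?_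
    simp only [hγ]
    fun_prop
  have hsum : volume T = (∑' i, ENNReal.ofReal (∏ n, α i n)) * volume T := by
    rw [← ENNReal.tsum_mul_right]
    simp only [← hvol]
    rw [← measure_iUnion₀ (fun i j hij => hdisj i j hij)
      fun i => (hTc.image (hcont i)).measurableSet.nullMeasurableSet]
    exact measure_congr (measure_symmDiff_eq_zero_iff.mp hsymm)
  have hone : ∑' i, ENNReal.ofReal (∏ n, α i n) = 1 :=
    (ENNReal.mul_left_inj hTpos.ne' hTc.measure_lt_top.ne).mp (by rw [one_mul, ← hsum])
  have hs := ENNReal.hasSum_toReal (hone ▸ ENNReal.one_ne_top)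
  rw [← ENNReal.tsum_toReal_eq fun _ => ENNReal.ofReal_ne_top, hone] at hs
  simpa [ENNReal.toReal_ofReal, hβ] using hs
end

section
/- Assume hypotheses H1 and H2. Then T equals the closure of the set {γ^{i_1} ∘ ⋯ ∘ γ^{i_p}(0) : p ≥ 0, i_1,…,i_p ∈ I} (for p = 0 this point is 0 itself); consequently, T is the smallest closed admissible set, i.e. T ⊆ X for every closed admissible set X ⊆ V^N. -/
open MeasureTheory

/-- The orbit of `x₀` under the semigroup generated by the maps `γ i`. -/
def mwOrbit {I β : Type*} (γ : I → β → β) (x₀ : β) : Set β :=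
  {y | ∃ p : ℕ, ∃ i : Fin p → I, mwComp γ i x₀ = y}

theorem mwComp_succ {I β : Type*} (γ : I → β → β) {p : ℕ} (i : Fin (p + 1) → I) (x : β) :
    mwComp γ i x = γ (i 0) (mwComp γ (fun k => i k.succ) x) := by
  simp [mwComp, List.ofFn_succ]

theorem mem_mwOrbit_self {I β : Type*} (γ : I → β → β) (x₀ : β) : x₀ ∈ mwOrbit γ x₀ :=
  ⟨0, Fin.elim0, by simp [mwComp]⟩

theorem apply_mem_mwOrbit {I β : Type*} {γ : I → β → β} {x₀ y : β} (hy : y ∈ mwOrbit γ x₀)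
    (j : I) : γ j y ∈ mwOrbit γ x₀ := by
  obtain ⟨p, i, rfl⟩ := hy
  exact ⟨p + 1, Fin.cons j i, by simp [mwComp_succ]⟩

theorem mwOrbit_subset {I β : Type*} {γ : I → β → β} {x₀ : β} {X : Set β} (h₀ : x₀ ∈ X)
    (hX : ∀ i, ∀ x ∈ X, γ i x ∈ X) : mwOrbit γ x₀ ⊆ X := by
  rintro _ ⟨p, i, rfl⟩
  induction p with
  | zero => simpa [mwComp] using h₀
  | succ p ih =>
    rw [mwComp_succ]
    exact hX _ _ (ih _)

/-- A bounded set contained in the closure of the union of its images under uniform contractions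
lies in the closure of every orbit. -/
theorem subset_closure_mwOrbit {I β : Type*} [PseudoMetricSpace β] {γ : I → β → β} {q : ℝ}
    (hq0 : 0 < q) (hq1 : q < 1) (hγ : ∀ i x y, dist (γ i x) (γ i y) ≤ q * dist x y)
    {T : Set β} (hT : Bornology.IsBounded T) (hcl : T ⊆ closure (⋃ i, γ i '' T)) (x₀ : β) :
    T ⊆ closure (mwOrbit γ x₀) := by
  have hne : (mwOrbit γ x₀).Nonempty := ⟨x₀, mem_mwOrbit_self γ x₀⟩
  obtain ⟨C, hC⟩ := hT.subset_closedBall x₀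
  have key : ∀ p : ℕ, ∀ x ∈ T, Metric.infDist x (mwOrbit γ x₀) ≤ q ^ p * C := by
    intro p
    induction p with
    | zero =>
      intro x hx
      simpa using (Metric.infDist_le_dist_of_mem (mem_mwOrbit_self γ x₀)).trans
        (Metric.mem_closedBall.1 (hC hx))
    | succ p ih =>
      have hclosed : IsClosed {x | Metric.infDist x (mwOrbit γ x₀) ≤ q ^ (p + 1) * C} :=
        isClosed_le (Metric.continuous_infDist_pt _) continuous_const
      refine hcl.trans (closure_minimal ?_ hclosed)
      refine Set.iUnion_subset fun i => Set.image_subset_iff.2 fun x hx => ?_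
      change Metric.infDist (γ i x) (mwOrbit γ x₀) ≤ q ^ (p + 1) * C
      have hstep : Metric.infDist (γ i x) (mwOrbit γ x₀) / q ≤
          Metric.infDist x (mwOrbit γ x₀) := by
        refine (Metric.le_infDist hne).2 fun {y} hy => ?_
        rw [div_le_iff₀' hq0]
        exact (Metric.infDist_le_dist_of_mem (apply_mem_mwOrbit hy i)).trans (hγ i x y)
      have := (div_le_iff₀' hq0).1 (hstep.trans (ih x hx))
      rwa [pow_succ', mul_assoc]
  intro x hx
  rw [Metric.mem_closure_iff_infDist_zero hne]
  refine le_antisymm ?_ Metric.infDist_nonneg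
  have hlim : Filter.Tendsto (fun p : ℕ => q ^ p * C) Filter.atTop (nhds 0) := by
    simpa using (tendsto_pow_atTop_nhds_zero_of_lt_one hq0.le hq1).mul_const C
  exact ge_of_tendsto' hlim fun p => key p x hx

/-- under (H1) and (H2), `T` is the closure of the set of points
`γ^{i_1} ∘ ⋯ ∘ γ^{i_p}(0)` and is the smallest closed admissible set. -/
theorem stmt7 {r s : ℕ} (hr : 0 < r) (hs : 0 < s)
    {I : Type*} [Countable I] [Nontrivial I]
    (α : I → Fin r → ℝ) (a : I → Fin r × Fin s → ℝ) (q : ℝ)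
    (hα : ∀ i n, 0 < α i n ∧ α i n < 1)
    (hqb : ∀ i n, α i n ≤ q) (hq1 : q < 1)
    (γ : I → (Fin r × Fin s → ℝ) → (Fin r × Fin s → ℝ))
    (hγ : ∀ i x l, γ i x l = α i l.1 * x l + a i l)
    (T : Set (Fin r × Fin s → ℝ)) (hTc : IsCompact T)
    (hT0 : (0 : Fin r × Fin s → ℝ) ∈ T)
    (hTadm : ∀ x ∈ T, ∀ i, mwPiG (γ i 0) (γ i x) ⊆ T)
    (hTpos : 0 < volume T)
    (hdisj : ∀ i j : I, i ≠ j → volume (γ i '' T ∩ γ j '' T) = 0)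
    (hsymm : volume (symmDiff T (⋃ i, γ i '' T)) = 0)
    (hclos : T = closure (⋃ i, γ i '' T)) :
    T = closure {y : Fin r × Fin s → ℝ | ∃ p : ℕ, ∃ i : Fin p → I, mwComp γ i 0 = y} ∧
    ∀ X : Set (Fin r × Fin s → ℝ), IsClosed X →
      ((0 : Fin r × Fin s → ℝ) ∈ X ∧ ∀ x ∈ X, ∀ i, mwPiG (γ i 0) (γ i x) ⊆ X) →
      T ⊆ X := by
  have hq0 : 0 < q := by
    obtain ⟨i⟩ : Nonempty I := inferInstance
    exact (hα i ⟨0, hr⟩).1.trans_le (hqb i ⟨0, hr⟩)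
  have hcontr : ∀ i x y, dist (γ i x) (γ i y) ≤ q * dist x y := by
    intro i x y
    refine (dist_pi_le_iff (by positivity)).2 fun l => ?_
    rw [hγ, hγ, dist_add_right, Real.dist_eq, ← mul_sub, abs_mul, abs_of_pos (hα i l.1).1]
    exact mul_le_mul (hqb i l.1) (dist_le_pi_dist x y l) (abs_nonneg _) hq0.le
  have hsub : T ⊆ closure (mwOrbit γ 0) :=
    subset_closure_mwOrbit hq0 hq1 hcontr hTc.isBounded hclos.subset 0
  have hmin : ∀ X : Set (Fin r × Fin s → ℝ), IsClosed X →
      ((0 : Fin r × Fin s → ℝ) ∈ X ∧ ∀ x ∈ X, ∀ i, mwPiG (γ i 0) (γ i x) ⊆ X) →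
      closure (mwOrbit γ 0) ⊆ X := fun X hX h =>
    closure_minimal
      (mwOrbit_subset h.1 fun i x hx => h.2 x hx i fun _ => Or.inr fun _ => rfl) hX
  exact ⟨hsub.antisymm (hmin T hTc.isClosed ⟨hT0, hTadm⟩),
    fun X hX h => hsub.trans (hmin X hX h)⟩
end

section
/- Assume hypotheses H1 and H2. Let X ⊆ ℝ^N be admissible and let f : ℝ^N → ℝ be a C^N-function. For p ≥ 1 and x ∈ X, the family (□f(γ^{i_1} ∘ ⋯ ∘ γ^{i_p}(0), γ^{i_1} ∘ ⋯ ∘ γ^{i_p}(x)))_{(i_1,…,i_p) ∈ I^p} is absolutely summable; denote its sum by 𝕄^p f(x). Then for every x ∈ X, lim_{p→∞} 𝕄^p f(x) = (1/μ(T)) (∫_T ∂_N f dμ) · ∏_{n∈N} x_n. Moreover, if X is compact, then the convergence is uniform on X. -/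
open MeasureTheory

/-- The increment of `f` in the coordinate `l` between the values `x l` and `y l`. -/
noncomputable def coordDiff {ι : Type*} [DecidableEq ι] (x y : ι → ℝ) (l : ι)
    (f : (ι → ℝ) → ℝ) : (ι → ℝ) → ℝ :=
  fun z => f (Function.update z l (y l)) - f (Function.update z l (x l))

theorem foldr_coordDiff_eq_sum {ι : Type*} [DecidableEq ι] (x y : ι → ℝ)
    (f : (ι → ℝ) → ℝ) (ls : List ι) (hls : ls.Nodup) (z : ι → ℝ) :
    ls.foldr (coordDiff x y) f z = ∑ M ∈ ls.toFinset.powerset, (-1 : ℝ) ^ M.card *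
      f (fun n => if n ∈ M then x n else if n ∈ ls then y n else z n) := by
  induction ls generalizing z with
  | nil => simp
  | cons l ls ih =>
    obtain ⟨hl, hnd⟩ := List.nodup_cons.1 hls
    have hl' : l ∉ ls.toFinset := by simpa using hl
    rw [List.toFinset_cons, Finset.sum_powerset_insert hl', List.foldr_cons, coordDiff,
      ih hnd, ih hnd, sub_eq_add_neg, ← Finset.sum_neg_distrib]
    congr 1 <;> refine Finset.sum_congr rfl fun M hM => ?_
    · have hlM : l ∉ M := fun h => hl' (Finset.mem_powerset.1 hM h)
      congr 2
      funext n
      rcases eq_or_ne n l with rfl | hn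
      · simp [hlM, hl]
      · simp [hn]
    · have hlM : l ∉ M := fun h => hl' (Finset.mem_powerset.1 hM h)
      rw [Finset.card_insert_of_notMem hlM, pow_succ, mul_neg_one, neg_mul]
      congr 3
      funext n
      rcases eq_or_ne n l with rfl | hn
      · simp [hlM, hl]
      · simp [hn]

theorem hasDerivAt_foldr_coordDiff {ι : Type*} [DecidableEq ι] (x y : ι → ℝ) {l : ι}
    {f f' : (ι → ℝ) → ℝ}
    (h : ∀ z, HasDerivAt (fun t => f (Function.update z l t)) (f' z) (z l))
    (ls : List ι) (hl : l ∉ ls) (z : ι → ℝ) :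
    HasDerivAt (fun t => ls.foldr (coordDiff x y) f (Function.update z l t))
      (ls.foldr (coordDiff x y) f' z) (z l) := by
  induction ls generalizing z with
  | nil => exact h z
  | cons n ls ih =>
    obtain ⟨hn, hl⟩ : l ≠ n ∧ l ∉ ls := by simpa using hl
    have key (c : ℝ) := ih hl (Function.update z n c)
    simp only [Function.update_of_ne hn, Function.update_comm hn.symm] at key
    exact (key (y n)).sub (key (x n))

theorem exists_uIcc_sub_eq_mul {φ φ' : ℝ → ℝ} (h : ∀ t, HasDerivAt φ (φ' t) t) (a b : ℝ) :
    ∃ c ∈ Set.uIcc a b, φ b - φ a = (b - a) * φ' c := by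
  have hc : Continuous φ := continuous_iff_continuousAt.2 fun t => (h t).continuousAt
  rcases lt_trichotomy a b with hab | rfl | hab
  · obtain ⟨c, hc, e⟩ := exists_hasDerivAt_eq_slope φ φ' hab hc.continuousOn fun t _ => h t
    refine ⟨c, Set.Icc_subset_uIcc (Set.Ioo_subset_Icc_self hc), ?_⟩
    rw [e, mul_div_cancel₀ _ (sub_ne_zero.2 hab.ne')]
  · exact ⟨a, Set.left_mem_uIcc, by simp⟩
  · obtain ⟨c, hc, e⟩ := exists_hasDerivAt_eq_slope φ φ' hab hc.continuousOn fun t _ => h t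
    refine ⟨c, Set.Icc_subset_uIcc' (Set.Ioo_subset_Icc_self hc), ?_⟩
    rw [e, ← neg_sub a b, neg_mul, mul_div_cancel₀ _ (sub_ne_zero.2 hab.ne'), neg_sub]

theorem mwExistsIterPD_append_singleton {ι : Type*} [DecidableEq ι] (ls : List ι) (l : ι)
    (f : (ι → ℝ) → ℝ) :
    mwExistsIterPD (ls ++ [l]) f ↔ mwExistsIterPD ls (mwPD l f) ∧
      ∀ x, DifferentiableAt ℝ (fun t => f (Function.update x l t)) (x l) := by
  induction ls with
  | nil => simp [mwExistsIterPD, mwIterPD]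
  | cons n ls ih =>
    have e : mwIterPD (ls ++ [l]) f = mwIterPD ls (mwPD l f) := by simp [mwIterPD]
    simp only [List.cons_append, mwExistsIterPD, ih, e]
    tauto

theorem exists_foldr_coordDiff_eq_mul {ι : Type*} [DecidableEq ι] (x y : ι → ℝ)
    (ls : List ι) (hls : ls.Nodup) (f : (ι → ℝ) → ℝ) (hf : mwExistsIterPD ls.reverse f)
    (z : ι → ℝ) :
    ∃ ξ : ι → ℝ, (∀ n ∈ ls, ξ n ∈ Set.uIcc (x n) (y n)) ∧ (∀ n ∉ ls, ξ n = z n) ∧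
      ls.foldr (coordDiff x y) f z =
        (ls.map fun n => y n - x n).prod * mwIterPD ls.reverse f ξ := by
  induction ls generalizing f z with
  | nil => exact ⟨z, by simp, by simp, by simp [mwIterPD]⟩
  | cons l ls ih =>
    obtain ⟨hl, hnd⟩ := List.nodup_cons.1 hls
    rw [List.reverse_cons, mwExistsIterPD_append_singleton] at hf
    have hd := hasDerivAt_foldr_coordDiff x y (f' := mwPD l f)
      (fun z => (hf.2 z).hasDerivAt) ls hl
    obtain ⟨c, hc, e⟩ := exists_uIcc_sub_eq_mul
      (φ := fun t => ls.foldr (coordDiff x y) f (Function.update z l t))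
      (φ' := fun t => ls.foldr (coordDiff x y) (mwPD l f) (Function.update z l t))
      (fun t => by simpa using hd (Function.update z l t)) (x l) (y l)
    obtain ⟨ξ, h1, h2, h3⟩ := ih hnd (mwPD l f) hf.1 (Function.update z l c)
    refine ⟨ξ, ?_, ?_, ?_⟩
    · intro n hn
      rcases List.mem_cons.1 hn with rfl | hn
      · rw [h2 n hl, Function.update_self]
        exact hc
      · exact h1 n hn
    · intro n hn
      rw [List.mem_cons, not_or] at hn
      rw [h2 n hn.2, Function.update_of_ne hn.1]
    · rw [List.foldr_cons, coordDiff, e, h3]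
      simp [mwIterPD, mul_assoc]

/-- Mean value theorem for the multidimensional increment. -/
theorem exists_mwBoxIncr_eq_prod_mul {r : ℕ} {f : (Fin r → ℝ) → ℝ} (hf : mwIsCN f)
    (x y : Fin r → ℝ) :
    ∃ ξ : Fin r → ℝ, (∀ n, ξ n ∈ Set.uIcc (x n) (y n)) ∧
      mwBoxIncr f x y = (∏ n, (y n - x n)) * mwDN f ξ := by
  set us := (Finset.univ : Finset (Fin r)).sort (· ≤ ·) with hus
  have hnd : us.reverse.Nodup := List.nodup_reverse.2 (Finset.sort_nodup _ _)
  have hmem (n : Fin r) : n ∈ us.reverse := by simp [hus]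
  have huniv : us.reverse.toFinset = Finset.univ := by ext; simp [hus]
  obtain ⟨ξ, h1, -, h3⟩ := exists_foldr_coordDiff_eq_mul x y us.reverse hnd f
    (by simpa using (hf Finset.univ).1) 0
  refine ⟨ξ, fun n => h1 n (hmem n), ?_⟩
  rw [foldr_coordDiff_eq_sum x y f _ hnd, huniv, ← List.prod_toFinset _ hnd, huniv,
    List.reverse_reverse] at h3
  simpa [mwBoxIncr, hmem, hus, mwDN] using h3

theorem mwComp_cons {I β : Type*} (γ : I → β → β) {p : ℕ} (j : I) (i : Fin p → I) :
    mwComp γ (Fin.cons j i : Fin (p + 1) → I) = γ j ∘ mwComp γ i := by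
  simp [mwComp, List.ofFn_succ]

theorem mwComp_zero {I β : Type*} (γ : I → β → β) (i : Fin 0 → I) : mwComp γ i = id := by
  simp [mwComp]

theorem mwComp_apply_eq_affine {r : ℕ} {I : Type*} {α a : I → Fin r → ℝ}
    {γ : I → (Fin r → ℝ) → (Fin r → ℝ)} (hγ : ∀ i x n, γ i x n = α i n * x n + a i n)
    {p : ℕ} (i : Fin p → I) (x : Fin r → ℝ) (n : Fin r) :
    mwComp γ i x n = (∏ k, α (i k) n) * x n + mwComp γ i 0 n := by
  induction p with
  | zero => simp [mwComp_zero]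
  | succ p ih =>
    induction i using Fin.consCases with
    | _ j i =>
      simp only [mwComp_cons, Function.comp_apply, hγ, Fin.prod_univ_succ, Fin.cons_zero,
        Fin.cons_succ]
      rw [ih i]
      ring

theorem mapsTo_mwComp {I β : Type*} {γ : I → β → β} {T : Set β}
    (h : ∀ i, Set.MapsTo (γ i) T T) {p : ℕ} (i : Fin p → I) :
    Set.MapsTo (mwComp γ i) T T := by
  induction p with
  | zero => simpa [mwComp_zero] using Set.mapsTo_id T
  | succ p ih =>
    induction i using Fin.consCases with
    | _ j i =>
      rw [mwComp_cons]
      exact (h j).comp (ih i)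

theorem measurable_mwComp {I β : Type*} [MeasurableSpace β] {γ : I → β → β}
    (h : ∀ i, Measurable (γ i)) {p : ℕ} (i : Fin p → I) : Measurable (mwComp γ i) := by
  induction p with
  | zero => simpa [mwComp_zero] using measurable_id
  | succ p ih =>
    induction i using Fin.consCases with
    | _ j i =>
      rw [mwComp_cons]
      exact (h j).comp (ih i)

/-- A measure that is self-similar under a family of maps is self-similar under all words of
length `p` in that family. -/
theorem eq_sum_smul_map_mwComp {I β : Type*} [MeasurableSpace β] {γ : I → β → β}
    (hγ : ∀ i, Measurable (γ i)) {ν : Measure β} {c : I → ENNReal}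
    (h : ∀ s, MeasurableSet s → ν s = ∑' i, c i * ν (γ i ⁻¹' s)) (p : ℕ) :
    ν = Measure.sum fun i : Fin p → I => (∏ k, c (i k)) • ν.map (mwComp γ i) := by
  have key (s : Set β) (hs : MeasurableSet s) :
      ν s = ∑' i : Fin p → I, (∏ k, c (i k)) * ν (mwComp γ i ⁻¹' s) := by
    induction p generalizing s with
    | zero => simp [mwComp_zero]
    | succ p ih =>
      rw [h s hs, ← (Fin.consEquiv fun _ : Fin (p + 1) => I).tsum_eq, ENNReal.tsum_prod']
      refine tsum_congr fun j => ?_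
      rw [ih _ (hγ j hs), ← ENNReal.tsum_mul_left]
      refine tsum_congr fun i => ?_
      have e : mwComp γ (Fin.consEquiv (fun _ : Fin (p + 1) => I) (j, i)) = γ j ∘ mwComp γ i :=
        mwComp_cons γ j i
      simp only [e, Fin.consEquiv_apply, Fin.prod_univ_succ, Fin.cons_zero, Fin.cons_succ,
        Set.preimage_comp, mul_assoc]
  ext s hs
  rw [Measure.sum_apply _ hs, key s hs]
  simp only [Measure.smul_apply, smul_eq_mul, Measure.map_apply (measurable_mwComp hγ _) hs]

theorem volume_image_diagonal_affine_s9 {r : ℕ} {α a : Fin r → ℝ} (hα : ∀ n, 0 < α n)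
    {γ : (Fin r → ℝ) → (Fin r → ℝ)} (hγ : ∀ x n, γ x n = α n * x n + a n)
    (s : Set (Fin r → ℝ)) :
    volume (γ '' s) = ENNReal.ofReal (∏ n, α n) * volume s := by
  have e : γ = (fun x => x + a) ∘ Matrix.toLin' (Matrix.diagonal α) := by
    funext x n
    simp [hγ, Matrix.mulVec_diagonal]
  rw [e, Set.image_comp, Set.image_add_right, measure_preimage_add_right,
    Measure.addHaar_image_linearMap, LinearMap.det_toLin', Matrix.det_diagonal,
    abs_of_pos (Finset.prod_pos fun n _ => hα n)]

/-- Lebesgue measure on a set tiled by its images under diagonal affine maps is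
self-similar. -/
theorem restrict_volume_apply_eq_tsum {r : ℕ} {I : Type*} [Countable I]
    {α a : I → Fin r → ℝ} (hα : ∀ i n, 0 < α i n)
    {γ : I → (Fin r → ℝ) → (Fin r → ℝ)} (hγ : ∀ i x n, γ i x n = α i n * x n + a i n)
    {T : Set (Fin r → ℝ)} (hTc : IsCompact T)
    (hdisj : ∀ i j : I, i ≠ j → volume (γ i '' T ∩ γ j '' T) = 0)
    (hsymm : volume (symmDiff T (⋃ i, γ i '' T)) = 0)
    (s : Set (Fin r → ℝ)) (hs : MeasurableSet s) :
    volume.restrict T s =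
      ∑' i, ENNReal.ofReal (∏ n, α i n) * volume.restrict T (γ i ⁻¹' s) := by
  have hcont (i : I) : Continuous (γ i) := by
    refine continuous_pi fun n => ?_
    simp only [hγ]
    fun_prop
  have hmeas (i : I) : MeasurableSet (γ i '' T) := (hTc.image (hcont i)).measurableSet
  have hT : T =ᵐ[volume] ⋃ i, γ i '' T := measure_symmDiff_eq_zero_iff.1 hsymm
  have hsum : volume.restrict T = Measure.sum fun i => volume.restrict (γ i '' T) := by
    rw [Measure.restrict_congr_set hT]
    exact Measure.restrict_iUnion_ae hdisj fun i => (hmeas i).nullMeasurableSet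
  conv_lhs => rw [hsum, Measure.sum_apply _ hs]
  refine tsum_congr fun i => ?_
  rw [Measure.restrict_apply hs, Measure.restrict_apply ((hcont i).measurable hs),
    ← volume_image_diagonal_affine_s9 (hα i) (hγ i), Set.image_preimage_inter]

/-- Decomposition of an integral over `T` along the tiles of level `p`. -/
theorem hasSum_prod_mul_setIntegral_mwComp {r : ℕ} {I : Type*} [Countable I]
    {α a : I → Fin r → ℝ} (hα : ∀ i n, 0 < α i n)
    {γ : I → (Fin r → ℝ) → (Fin r → ℝ)} (hγ : ∀ i x n, γ i x n = α i n * x n + a i n)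
    {T : Set (Fin r → ℝ)} (hTc : IsCompact T)
    (hdisj : ∀ i j : I, i ≠ j → volume (γ i '' T ∩ γ j '' T) = 0)
    (hsymm : volume (symmDiff T (⋃ i, γ i '' T)) = 0)
    {g : (Fin r → ℝ) → ℝ} (hg : Continuous g) (p : ℕ) :
    HasSum (fun i : Fin p → I => (∏ n, ∏ k, α (i k) n) * ∫ t in T, g (mwComp γ i t))
      (∫ t in T, g t) := by
  have hmeas (i : I) : Measurable (γ i) := by
    refine measurable_pi_iff.2 fun n => ?_
    simp only [hγ]
    fun_prop
  have hν := eq_sum_smul_map_mwComp hmeas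
    (restrict_volume_apply_eq_tsum hα hγ hTc hdisj hsymm) p
  have hint : Integrable g (volume.restrict T) := hg.continuousOn.integrableOn_compact hTc
  rw [hν] at hint
  have hsum := hasSum_integral_measure hint
  rw [← hν] at hsum
  convert! hsum using 2 with i
  rw [integral_smul_measure, integral_map (measurable_mwComp hmeas i).aemeasurable
    hg.aestronglyMeasurable, ENNReal.toReal_prod, Finset.prod_comm, smul_eq_mul]
  congr 1
  exact Finset.prod_congr rfl fun k _ =>
    (ENNReal.toReal_ofReal (Finset.prod_nonneg fun n _ => (hα _ n).le)).symm

theorem prod_word_mem_Icc {r : ℕ} {I : Type*} {α : I → Fin r → ℝ} {q : ℝ}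
    (hα : ∀ i n, 0 < α i n) (hqb : ∀ i n, α i n ≤ q) {p : ℕ} (i : Fin p → I) (n : Fin r) :
    ∏ k, α (i k) n ∈ Set.Icc 0 (q ^ p) := by
  refine ⟨Finset.prod_nonneg fun k _ => (hα _ n).le, ?_⟩
  simpa using Finset.prod_le_prod (fun k _ => (hα (i k) n).le)
    (fun k (_ : k ∈ Finset.univ) => hqb (i k) n)

theorem dist_mwComp_mwComp_zero_le {r : ℕ} {I : Type*} {α a : I → Fin r → ℝ} {q : ℝ}
    (hα : ∀ i n, 0 < α i n) (hqb : ∀ i n, α i n ≤ q) (hq0 : 0 ≤ q)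
    {γ : I → (Fin r → ℝ) → (Fin r → ℝ)} (hγ : ∀ i x n, γ i x n = α i n * x n + a i n)
    {p : ℕ} (i : Fin p → I) (x : Fin r → ℝ) :
    dist (mwComp γ i x) (mwComp γ i 0) ≤ q ^ p * ‖x‖ := by
  refine (dist_pi_le_iff (by positivity)).2 fun n => ?_
  obtain ⟨h0, h1⟩ := prod_word_mem_Icc hα hqb i n
  rw [mwComp_apply_eq_affine hγ i x n, Real.dist_eq, add_sub_cancel_right, abs_mul,
    abs_of_nonneg h0]
  exact mul_le_mul h1 (norm_le_pi_norm x n) (abs_nonneg _) (h0.trans h1)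

theorem exists_mwBoxIncr_mwComp_eq {r : ℕ} {I : Type*} {α a : I → Fin r → ℝ} {q : ℝ}
    (hα : ∀ i n, 0 < α i n) (hqb : ∀ i n, α i n ≤ q) (hq0 : 0 ≤ q)
    {γ : I → (Fin r → ℝ) → (Fin r → ℝ)} (hγ : ∀ i x n, γ i x n = α i n * x n + a i n)
    {f : (Fin r → ℝ) → ℝ} (hf : mwIsCN f) {p : ℕ} (i : Fin p → I) (x : Fin r → ℝ) :
    ∃ ξ, dist ξ (mwComp γ i 0) ≤ q ^ p * ‖x‖ ∧
      mwBoxIncr f (mwComp γ i 0) (mwComp γ i x) =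
        (∏ n, ∏ k, α (i k) n) * (∏ n, x n) * mwDN f ξ := by
  obtain ⟨ξ, hξ, e⟩ := exists_mwBoxIncr_eq_prod_mul hf (mwComp γ i 0) (mwComp γ i x)
  refine ⟨ξ, (dist_pi_le_iff (by positivity)).2 fun n => ?_, ?_⟩
  · calc dist (ξ n) (mwComp γ i 0 n)
        ≤ dist (mwComp γ i x n) (mwComp γ i 0 n) := Set.abs_sub_left_of_mem_uIcc (hξ n)
      _ ≤ dist (mwComp γ i x) (mwComp γ i 0) := dist_le_pi_dist _ _ n
      _ ≤ q ^ p * ‖x‖ := dist_mwComp_mwComp_zero_le hα hqb hq0 hγ i x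
  · rw [e, ← Finset.prod_mul_distrib]
    congr 1
    refine Finset.prod_congr rfl fun n _ => ?_
    rw [mwComp_apply_eq_affine hγ i x n, add_sub_cancel_right]

theorem abs_sub_inv_mul_setIntegral_le {X : Type*} [MeasurableSpace X] {μ : Measure X}
    {T : Set X} (hT : MeasurableSet T) (h0 : μ T ≠ 0) (htop : μ T ≠ ⊤) {h : X → ℝ}
    (hint : IntegrableOn h T μ) {c ε : ℝ} (hc : ∀ t ∈ T, |c - h t| ≤ ε) :
    |c - (μ T).toReal⁻¹ * ∫ t in T, h t ∂μ| ≤ ε := by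
  have := (convex_closedBall c ε).set_average_mem Metric.isClosed_closedBall h0 htop
    (ae_restrict_of_forall_mem hT fun t ht => by
      rw [Metric.mem_closedBall, dist_comm]; exact hc t ht) hint
  rw [setAverage_eq, Metric.mem_closedBall, dist_comm] at this
  exact this

theorem mem_closedBall_of_dist_mwComp_le {r : ℕ} {I : Type*} {γ : I → (Fin r → ℝ) → (Fin r → ℝ)}
    {T : Set (Fin r → ℝ)} (hT0 : (0 : Fin r → ℝ) ∈ T) (hmaps : ∀ i, Set.MapsTo (γ i) T T)
    {RT R q : ℝ} (hRT : T ⊆ Metric.closedBall 0 RT) (hq0 : 0 ≤ q) (hq1 : q ≤ 1) {p : ℕ}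
    (i : Fin p → I) {x ξ : Fin r → ℝ} (hx : x ∈ Metric.closedBall 0 R)
    (hξ : dist ξ (mwComp γ i 0) ≤ q ^ p * ‖x‖) : ξ ∈ Metric.closedBall 0 (RT + R) := by
  have h1 := hRT (mapsTo_mwComp hmaps i hT0)
  have h2 : q ^ p * ‖x‖ ≤ ‖x‖ :=
    mul_le_of_le_one_left (norm_nonneg x) (pow_le_one₀ hq0 hq1)
  rw [Metric.mem_closedBall] at h1 ⊢
  rw [mem_closedBall_zero_iff] at hx
  linarith [dist_triangle ξ (mwComp γ i 0) 0]

theorem hasSum_prod_word {r : ℕ} {I : Type*} [Countable I]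
    {α a : I → Fin r → ℝ} (hα : ∀ i n, 0 < α i n)
    {γ : I → (Fin r → ℝ) → (Fin r → ℝ)} (hγ : ∀ i x n, γ i x n = α i n * x n + a i n)
    {T : Set (Fin r → ℝ)} (hTc : IsCompact T) (hTpos : 0 < volume T)
    (hdisj : ∀ i j : I, i ≠ j → volume (γ i '' T ∩ γ j '' T) = 0)
    (hsymm : volume (symmDiff T (⋃ i, γ i '' T)) = 0) (p : ℕ) :
    HasSum (fun i : Fin p → I => ∏ n, ∏ k, α (i k) n) 1 := by
  have hV : (volume T).toReal ≠ 0 :=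
    (ENNReal.toReal_pos hTpos.ne' hTc.measure_lt_top.ne).ne'
  have h := hasSum_prod_mul_setIntegral_mwComp hα hγ hTc hdisj hsymm
    (continuous_const (y := (1 : ℝ))) p
  have h' := h.mul_right (volume T).toReal⁻¹
  simpa [Measure.real, hV, mul_assoc] using h'

theorem summable_abs_mwBoxIncr_mwComp {r : ℕ} {I : Type*} [Countable I]
    {α a : I → Fin r → ℝ} {q : ℝ} (hα : ∀ i n, 0 < α i n) (hqb : ∀ i n, α i n ≤ q)
    (hq0 : 0 ≤ q) (hq1 : q < 1)
    {γ : I → (Fin r → ℝ) → (Fin r → ℝ)} (hγ : ∀ i x n, γ i x n = α i n * x n + a i n)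
    {T : Set (Fin r → ℝ)} (hTc : IsCompact T) (hT0 : (0 : Fin r → ℝ) ∈ T)
    (hmaps : ∀ i, Set.MapsTo (γ i) T T) (hTpos : 0 < volume T)
    (hdisj : ∀ i j : I, i ≠ j → volume (γ i '' T ∩ γ j '' T) = 0)
    (hsymm : volume (symmDiff T (⋃ i, γ i '' T)) = 0)
    {f : (Fin r → ℝ) → ℝ} (hf : mwIsCN f) (p : ℕ) (x : Fin r → ℝ) :
    Summable fun i : Fin p → I => |mwBoxIncr f (mwComp γ i 0) (mwComp γ i x)| := by
  obtain ⟨RT, hRT⟩ := hTc.isBounded.subset_closedBall 0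
  have hg : Continuous (mwDN f) := (hf Finset.univ).2
  obtain ⟨C, hC⟩ := (isCompact_closedBall (0 : Fin r → ℝ) (RT + ‖x‖)).exists_bound_of_continuousOn
    hg.continuousOn
  have hA := (hasSum_prod_word hα hγ hTc hTpos hdisj hsymm p).summable
  refine Summable.of_nonneg_of_le (fun _ => abs_nonneg _) (fun i => ?_)
    (hA.mul_right (|∏ n, x n| * C))
  obtain ⟨ξ, hξ, e⟩ := exists_mwBoxIncr_mwComp_eq hα hqb hq0 hγ hf i x
  have hA0 : 0 ≤ ∏ n, ∏ k, α (i k) n :=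
    Finset.prod_nonneg fun n _ => (prod_word_mem_Icc hα hqb i n).1
  have hb := hC ξ (mem_closedBall_of_dist_mwComp_le hT0 hmaps hRT hq0 hq1.le i (by simp) hξ)
  rw [e, abs_mul, abs_mul, abs_of_nonneg hA0, mul_assoc]
  gcongr
  exact hb

/-- The iterates converge uniformly on every ball. -/
theorem tendstoUniformlyOn_mwMWp_closedBall {r : ℕ} {I : Type*} [Countable I]
    {α a : I → Fin r → ℝ} {q : ℝ} (hα : ∀ i n, 0 < α i n) (hqb : ∀ i n, α i n ≤ q)
    (hq0 : 0 ≤ q) (hq1 : q < 1)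
    {γ : I → (Fin r → ℝ) → (Fin r → ℝ)} (hγ : ∀ i x n, γ i x n = α i n * x n + a i n)
    {T : Set (Fin r → ℝ)} (hTc : IsCompact T) (hT0 : (0 : Fin r → ℝ) ∈ T)
    (hmaps : ∀ i, Set.MapsTo (γ i) T T) (hTpos : 0 < volume T)
    (hdisj : ∀ i j : I, i ≠ j → volume (γ i '' T ∩ γ j '' T) = 0)
    (hsymm : volume (symmDiff T (⋃ i, γ i '' T)) = 0)
    {f : (Fin r → ℝ) → ℝ} (hf : mwIsCN f) (R : ℝ) :
    TendstoUniformlyOn (fun p : ℕ => fun x => mwMWp γ f p x)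
      (fun x => (volume T).toReal⁻¹ * (∫ t in T, mwDN f t) * ∏ n, x n)
      Filter.atTop (Metric.closedBall 0 R) := by
  rcases lt_or_ge R 0 with hR | hR
  · rw [Metric.closedBall_eq_empty.2 hR]
    exact tendstoUniformlyOn_empty
  obtain ⟨RT, hRT⟩ := hTc.isBounded.subset_closedBall 0
  have hg : Continuous (mwDN f) := (hf Finset.univ).2
  have huc := (isCompact_closedBall (0 : Fin r → ℝ) (RT + R)).uniformContinuousOn_of_continuous
    hg.continuousOn
  have hcomp {p : ℕ} (i : Fin p → I) : Continuous (mwComp γ i) :=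
    continuous_pi fun n => by
      rw [funext fun x => mwComp_apply_eq_affine hγ i x n]
      fun_prop
  rw [Metric.tendstoUniformlyOn_iff]
  intro ε hε
  obtain ⟨δ, hδ, hosc⟩ := Metric.uniformContinuousOn_iff.1 huc (ε / (R ^ r + 1)) (by positivity)
  have hlim : Filter.Tendsto (fun p : ℕ => q ^ p * (R + RT)) Filter.atTop (nhds 0) := by
    simpa using (tendsto_pow_atTop_nhds_zero_of_lt_one hq0 hq1).mul_const (R + RT)
  filter_upwards [hlim.eventually_lt_const hδ] with p hp x hx
  have hxR : ‖x‖ ≤ R := mem_closedBall_zero_iff.1 hx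
  have hA := hasSum_prod_word hα hγ hTc hTpos hdisj hsymm p
  have hbox := (summable_abs_mwBoxIncr_mwComp hα hqb hq0 hq1 hγ hTc hT0 hmaps hTpos hdisj hsymm
    hf p x).of_abs.hasSum
  have hint := ((hasSum_prod_mul_setIntegral_mwComp hα hγ hTc hdisj hsymm hg p).mul_left
    (volume T).toReal⁻¹).mul_right (∏ n, x n)
  have hbound := (hint.sub hbox).norm_le_of_bounded
    (hA.mul_right (|∏ n, x n| * (ε / (R ^ r + 1)))) fun i => by
    obtain ⟨ξ, hξ, e⟩ := exists_mwBoxIncr_mwComp_eq hα hqb hq0 hγ hf i x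
    have hA0 : 0 ≤ ∏ n, ∏ k, α (i k) n :=
      Finset.prod_nonneg fun n _ => (prod_word_mem_Icc hα hqb i n).1
    have hav := abs_sub_inv_mul_setIntegral_le hTc.measurableSet hTpos.ne' hTc.measure_lt_top.ne
      ((hg.comp (hcomp i)).continuousOn.integrableOn_compact hTc)
      (c := mwDN f ξ) (ε := ε / (R ^ r + 1)) fun t ht => by
        have hRT' := hRT (mapsTo_mwComp hmaps i ht)
        refine (hosc ξ (mem_closedBall_of_dist_mwComp_le hT0 hmaps hRT hq0 hq1.le i hx hξ) _
          (Metric.closedBall_subset_closedBall (by linarith) hRT') ?_).le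
        have h1 := dist_mwComp_mwComp_zero_le hα hqb hq0 hγ i t
        have h2 : q ^ p * ‖x‖ ≤ q ^ p * R := by gcongr
        have h3 : q ^ p * ‖t‖ ≤ q ^ p * RT := by
          gcongr
          exact mem_closedBall_zero_iff.1 (hRT ht)
        linarith [dist_triangle_right ξ (mwComp γ i t) (mwComp γ i 0)]
    have hfac : (volume T).toReal⁻¹ * ((∏ n, ∏ k, α (i k) n) *
          ∫ t in T, mwDN f (mwComp γ i t)) * (∏ n, x n) -
        mwBoxIncr f (mwComp γ i 0) (mwComp γ i x) =
        -((∏ n, ∏ k, α (i k) n) * ((∏ n, x n) * (mwDN f ξ -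
          (volume T).toReal⁻¹ * ∫ t in T, mwDN f (mwComp γ i t)))) := by
      rw [e]
      ring
    rw [hfac, norm_neg, Real.norm_eq_abs, abs_mul, abs_mul, abs_of_nonneg hA0]
    gcongr
    exact hav
  have hprod : |∏ n, x n| ≤ R ^ r := by
    rw [Finset.abs_prod]
    simpa using Finset.prod_le_prod (fun n _ => abs_nonneg (x n))
      (fun n (_ : n ∈ Finset.univ) => (norm_le_pi_norm x n).trans hxR)
  rw [Real.dist_eq]
  refine lt_of_le_of_lt hbound ?_
  rw [one_mul, ← mul_div_assoc, div_lt_iff₀ (by positivity)]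
  nlinarith [mul_le_mul_of_nonneg_right hprod hε.le]

/-- for a `C^N`-function `f`, the iterates `𝕄^p f` are well defined on an
admissible set `X` and converge pointwise (uniformly, if `X` is compact) to
`(1/μ(T)) (∫_T ∂_N f dμ) ∏_n x_n`. -/
theorem stmt9 {r : ℕ} (hr : 0 < r) {I : Type*} [Countable I] [Nontrivial I]
    (α a : I → Fin r → ℝ) (q : ℝ)
    (hα : ∀ i n, 0 < α i n ∧ α i n < 1)
    (hqb : ∀ i n, α i n ≤ q) (hq1 : q < 1)
    (γ : I → (Fin r → ℝ) → (Fin r → ℝ))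
    (hγ : ∀ i x n, γ i x n = α i n * x n + a i n)
    (T : Set (Fin r → ℝ)) (hTc : IsCompact T)
    (hT0 : (0 : Fin r → ℝ) ∈ T)
    (hTadm : ∀ x ∈ T, ∀ i, mwPi (γ i 0) (γ i x) ⊆ T)
    (hTpos : 0 < volume T)
    (hdisj : ∀ i j : I, i ≠ j → volume (γ i '' T ∩ γ j '' T) = 0)
    (hsymm : volume (symmDiff T (⋃ i, γ i '' T)) = 0)
    (hclos : T = closure (⋃ i, γ i '' T))
    (X : Set (Fin r → ℝ))
    (hX0 : (0 : Fin r → ℝ) ∈ X)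
    (hXadm : ∀ x ∈ X, ∀ i, mwPi (γ i 0) (γ i x) ⊆ X)
    (f : (Fin r → ℝ) → ℝ) (hf : mwIsCN f) :
    (∀ p : ℕ, 1 ≤ p → ∀ x ∈ X,
      Summable (fun i : Fin p → I =>
        |mwBoxIncr f (mwComp γ i 0) (mwComp γ i x)|)) ∧
    (∀ x ∈ X, Filter.Tendsto (fun p : ℕ => mwMWp γ f p x) Filter.atTop
      (nhds ((volume T).toReal⁻¹ * (∫ t in T, mwDN f t) * ∏ n, x n))) ∧
    (IsCompact X → TendstoUniformlyOn (fun p : ℕ => fun x => mwMWp γ f p x)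
      (fun x => (volume T).toReal⁻¹ * (∫ t in T, mwDN f t) * ∏ n, x n)
      Filter.atTop X) := by
  have hα0 : ∀ i n, 0 < α i n := fun i n => (hα i n).1
  obtain ⟨j⟩ : Nonempty I := inferInstance
  have hq0 : 0 ≤ q := (hα0 j ⟨0, hr⟩).le.trans (hqb j ⟨0, hr⟩)
  have hmaps : ∀ i, Set.MapsTo (γ i) T T := fun i x hx => hTadm x hx i fun _ => Or.inr rfl
  have hunif := tendstoUniformlyOn_mwMWp_closedBall hα0 hqb hq0 hq1 hγ hTc hT0 hmaps hTpos
    hdisj hsymm hf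
  refine ⟨fun p _ x _ => summable_abs_mwBoxIncr_mwComp hα0 hqb hq0 hq1 hγ hTc hT0 hmaps hTpos
    hdisj hsymm hf p x, fun x _ => (hunif ‖x‖).tendsto_at (by simp), fun hX => ?_⟩
  obtain ⟨R, hR⟩ := hX.isBounded.subset_closedBall 0
  exact (hunif R).mono hR
end

section
/- Assume hypotheses H1 and H2. Let X ⊆ ℝ^N be admissible and let f : X → ℝ admit an extension to a C^N-function on ℝ^N. Then f satisfies 𝕄f = f on X (the defining families being absolutely summable) if and only if there exists λ ∈ ℝ such that f(x) = λ ∏_{n∈N} x_n for every x ∈ X. -/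
open MeasureTheory

section MixedDifferences

variable {ι : Type*} [DecidableEq ι]

theorem mwPD_comp_update {l m : ι} (h : m ≠ l) (c : ℝ) (f : (ι → ℝ) → ℝ) :
    mwPD m (fun x => f (Function.update x l c)) =
      fun x => mwPD m f (Function.update x l c) := by
  funext x
  simp only [mwPD, Function.update_of_ne h, Function.update_comm h]

theorem mwIterPD_comp_update {l : ι} (c : ℝ) (f : (ι → ℝ) → ℝ) :
    ∀ {ls : List ι}, l ∉ ls →
      mwIterPD ls (fun x => f (Function.update x l c)) =
        fun x => mwIterPD ls f (Function.update x l c)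
  | [], _ => rfl
  | m :: ls, h => by
    rw [List.mem_cons, not_or] at h
    change mwPD m (mwIterPD ls _) = fun x => mwPD m (mwIterPD ls f) _
    rw [mwIterPD_comp_update c f h.2, mwPD_comp_update (Ne.symm h.1)]

theorem mwExistsIterPD.comp_update {l : ι} (c : ℝ) {f : (ι → ℝ) → ℝ} :
    ∀ {ls : List ι}, l ∉ ls → mwExistsIterPD ls f →
      mwExistsIterPD ls (fun x => f (Function.update x l c))
  | [], _, _ => trivial
  | m :: ls, h, hf => by
    rw [List.mem_cons, not_or] at h
    refine ⟨hf.1.comp_update c h.2, fun x => ?_⟩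
    have := hf.2 (Function.update x l c)
    rw [mwIterPD_comp_update c f h.2]
    simpa only [Function.update_of_ne (Ne.symm h.1), Function.update_comm (Ne.symm h.1)]
      using this

theorem mwIterPD_sub {f g : (ι → ℝ) → ℝ} :
    ∀ {ls : List ι}, mwExistsIterPD ls f → mwExistsIterPD ls g →
      mwIterPD ls (fun x => f x - g x) = fun x => mwIterPD ls f x - mwIterPD ls g x
  | [], _, _ => rfl
  | m :: ls, hf, hg => by
    change mwPD m (mwIterPD ls _) = fun x => mwPD m (mwIterPD ls f) x - mwPD m (mwIterPD ls g) x
    rw [mwIterPD_sub hf.1 hg.1]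
    funext x
    exact deriv_fun_sub (hf.2 x) (hg.2 x)

theorem mwExistsIterPD.sub {f g : (ι → ℝ) → ℝ} :
    ∀ {ls : List ι}, mwExistsIterPD ls f → mwExistsIterPD ls g →
      mwExistsIterPD ls (fun x => f x - g x)
  | [], _, _ => trivial
  | m :: ls, hf, hg => by
    refine ⟨hf.1.sub hg.1, fun x => ?_⟩
    rw [mwIterPD_sub hf.1 hg.1]
    exact (hf.2 x).fun_sub (hg.2 x)

theorem exists_mem_uIcc_sub_eq_mul_deriv {F : ℝ → ℝ} (hF : Differentiable ℝ F) (a b : ℝ) :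
    ∃ c ∈ Set.uIcc a b, F b - F a = (b - a) * deriv F c := by
  wlog hab : a ≤ b generalizing a b
  · obtain ⟨c, hc, h⟩ := this b a (le_of_not_ge hab)
    exact ⟨c, Set.uIcc_comm a b ▸ hc, by linarith⟩
  rcases hab.eq_or_lt with rfl | hab
  · exact ⟨a, Set.left_mem_uIcc, by simp⟩
  · obtain ⟨c, hc, h⟩ := exists_deriv_eq_slope F hab hF.continuous.continuousOn hF.differentiableOn
    refine ⟨c, Set.uIcc_of_le hab.le ▸ Set.Ioo_subset_Icc_self hc, ?_⟩
    rw [h, mul_div_cancel₀ _ (sub_ne_zero.2 hab.ne')]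

/-- Mean value theorem for mixed differences in the coordinates of a list. -/
theorem exists_sum_powerset_eq_prod_mul_mwIterPD (y z : ι → ℝ) :
    ∀ {ls : List ι} {f : (ι → ℝ) → ℝ}, ls.Nodup → mwExistsIterPD ls f →
      ∃ ξ : ι → ℝ, (∀ n, ξ n ∈ Set.uIcc (y n) (z n)) ∧
        ∑ M ∈ ls.toFinset.powerset, (-1 : ℝ) ^ M.card * f (fun n => if n ∈ M then y n else z n) =
          (∏ n ∈ ls.toFinset, (z n - y n)) * mwIterPD ls f ξ
  | [], f, _, _ => ⟨z, fun _ => Set.right_mem_uIcc, by simp [mwIterPD]⟩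
  | l :: ls, f, hls, hf => by
    obtain ⟨hl, hls⟩ := List.nodup_cons.1 hls
    have hz := hf.1.comp_update (z l) hl
    have hy := hf.1.comp_update (y l) hl
    obtain ⟨ξ, hξ, h⟩ := exists_sum_powerset_eq_prod_mul_mwIterPD y z hls (hz.sub hy)
    have hd : Differentiable ℝ (fun t => mwIterPD ls f (Function.update ξ l t)) := fun t => by
      simpa using hf.2 (Function.update ξ l t)
    obtain ⟨c, hc, hmv⟩ := exists_mem_uIcc_sub_eq_mul_deriv hd (y l) (z l)
    refine ⟨Function.update ξ l c, fun n => ?_, ?_⟩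
    · rcases eq_or_ne n l with rfl | hn
      · simpa using hc
      · simpa [hn] using hξ n
    have hl' : l ∉ ls.toFinset := by simpa using hl
    have hD : mwIterPD (l :: ls) f (Function.update ξ l c) =
        deriv (fun t => mwIterPD ls f (Function.update ξ l t)) c := by
      change mwPD l (mwIterPD ls f) _ = _
      simp [mwPD]
    rw [mwIterPD_sub hz hy, mwIterPD_comp_update _ _ hl, mwIterPD_comp_update _ _ hl] at h
    beta_reduce at h
    rw [hmv] at h
    rw [List.toFinset_cons, Finset.sum_powerset_insert hl', ← Finset.sum_add_distrib,
      Finset.prod_insert hl', hD, mul_comm (z l - y l), mul_assoc, ← h]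
    refine Finset.sum_congr rfl fun M hM => ?_
    have hlM : l ∉ M := fun h => hl' (Finset.mem_powerset.1 hM h)
    have e₁ : Function.update (fun n => if n ∈ M then y n else z n) l (z l) =
        fun n => if n ∈ M then y n else z n := by
      rw [Function.update_eq_self_iff]; simp [hlM]
    have e₂ : Function.update (fun n => if n ∈ M then y n else z n) l (y l) =
        fun n => if n ∈ insert l M then y n else z n := by
      funext n
      rcases eq_or_ne n l with rfl | hn
      · simp
      · simp [hn]
    rw [e₁, e₂, Finset.card_insert_of_notMem hlM]
    ring

end MixedDifferences

theorem exists_mwBoxIncr_eq_prod_mul_mwDN {r : ℕ} {f : (Fin r → ℝ) → ℝ} (hf : mwIsCN f)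
    (y z : Fin r → ℝ) :
    ∃ ξ : Fin r → ℝ, (∀ n, ξ n ∈ Set.uIcc (y n) (z n)) ∧
      mwBoxIncr f y z = (∏ n, (z n - y n)) * mwDN f ξ := by
  have h := exists_sum_powerset_eq_prod_mul_mwIterPD y z
    (Finset.sort_nodup (Finset.univ : Finset (Fin r)) (· ≤ ·)) (hf Finset.univ).1
  simpa [mwBoxIncr, mwDN] using h

section BoxIncrement

variable {N : Type*} [Fintype N] [DecidableEq N]

theorem mwBoxIncr_congr {α : Type*} {f g : (N → α) → ℝ} {x y : N → α}
    (h : ∀ z ∈ mwPi x y, f z = g z) : mwBoxIncr f x y = mwBoxIncr g x y := by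
  refine Finset.sum_congr rfl fun M _ => ?_
  rw [h]
  intro n
  by_cases hn : n ∈ M <;> simp [hn]

theorem mwBoxIncr_mul_prod (c : ℝ) (x y : N → ℝ) :
    mwBoxIncr (fun z => c * ∏ n, z n) x y = c * ∏ n, (y n - x n) := by
  simp only [sub_eq_neg_add, Finset.prod_add, Finset.mul_sum, mwBoxIncr]
  rw [Finset.powerset_univ]
  refine Finset.sum_congr rfl fun M _ => ?_
  rw [Finset.prod_neg, Finset.prod_ite, ← Finset.sdiff_eq_filter]
  simp
  ring

/-- The alternating sum of increments with a common first corner only depends on the vertices. -/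
theorem sum_mwBoxIncr_eq {α : Type*} (f : (N → α) → ℝ) (c y z : N → α) :
    ∑ M : Finset N, (-1 : ℝ) ^ M.card * mwBoxIncr f c (fun n => if n ∈ M then y n else z n) =
      mwBoxIncr f y z := by
  simp only [mwBoxIncr, Finset.mul_sum]
  rw [Finset.sum_comm, Finset.sum_eq_single ∅]
  · simp
  · intro L _ hL
    obtain ⟨k, hk⟩ := Finset.nonempty_iff_ne_empty.2 hL
    have key : ∀ M : Finset N,
        (fun n => if n ∈ L then c n else if n ∈ insert k M then y n else z n) =
          fun n => if n ∈ L then c n else if n ∈ M then y n else z n := by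
      intro M
      funext n
      rcases eq_or_ne n k with rfl | hn
      · simp [hk]
      · simp [hn]
    have hu : (Finset.univ : Finset (Finset N)) = (insert k (Finset.univ.erase k)).powerset := by
      rw [Finset.insert_erase (Finset.mem_univ k), Finset.powerset_univ]
    rw [hu, Finset.sum_powerset_insert (Finset.notMem_erase k _), ← Finset.sum_add_distrib]
    refine Finset.sum_eq_zero fun M hM => ?_
    have hkM : k ∉ M := fun h => Finset.notMem_erase k _ (Finset.mem_powerset.1 hM h)
    rw [key M, Finset.card_insert_of_notMem hkM]
    ring
  · simp

end BoxIncrement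

/-- Iterates of the averaging operator `g ↦ ∑ i, w i * g (γ i ·)`. -/
noncomputable def averageIter {I E : Type*} (w : I → ℝ) (γ : I → E → E) (g : E → ℝ) :
    ℕ → E → ℝ
  | 0 => g
  | p + 1 => fun x => ∑' i, w i * averageIter w γ g p (γ i x)

theorem abs_averageIter_le {I E : Type*} {w : I → ℝ} {γ : I → E → E} {g : E → ℝ} {T : Set E}
    {C : ℝ} (hw : ∀ i, 0 ≤ w i) (hw1 : HasSum w 1) (hT : ∀ x ∈ T, ∀ i, γ i x ∈ T)
    (hC : ∀ x ∈ T, |g x| ≤ C) : ∀ (p : ℕ), ∀ x ∈ T, |averageIter w γ g p x| ≤ C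
  | 0, x, hx => hC x hx
  | p + 1, x, hx => by
    rw [averageIter, ← Real.norm_eq_abs]
    refine tsum_of_norm_bounded (by simpa using hw1.mul_right C) fun i => ?_
    rw [norm_mul, Real.norm_of_nonneg (hw i)]
    exact mul_le_mul_of_nonneg_left
      (abs_averageIter_le hw hw1 hT hC p _ (hT x hx i)) (hw i)

theorem summable_mul_averageIter {I E : Type*} {w : I → ℝ} {γ : I → E → E} {g : E → ℝ}
    {T : Set E} {C : ℝ} (hw : ∀ i, 0 ≤ w i) (hw1 : HasSum w 1)
    (hT : ∀ x ∈ T, ∀ i, γ i x ∈ T) (hC : ∀ x ∈ T, |g x| ≤ C) (p : ℕ) {x : E} (hx : x ∈ T) :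
    Summable fun i => w i * averageIter w γ g p (γ i x) := by
  refine Summable.of_norm_bounded (hw1.summable.mul_right C) fun i => ?_
  rw [norm_mul, Real.norm_of_nonneg (hw i)]
  exact mul_le_mul_of_nonneg_left
    (abs_averageIter_le hw hw1 hT hC p _ (hT x hx i)) (hw i)

/-- Termwise approximations of a sum by `P * (w i * c i)` add up. -/
theorem HasSum.abs_sub_mul_tsum_le {I : Type*} {w b c : I → ℝ} {s P ε : ℝ} (hb : HasSum b s)
    (hw1 : HasSum w 1) (hc : Summable fun i => w i * c i)
    (h : ∀ i, |b i - w i * P * c i| ≤ w i * |P| * ε) :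
    |s - P * ∑' i, w i * c i| ≤ |P| * ε := by
  have hs := hb.sub (hc.hasSum.mul_left P)
  have hB : HasSum (fun i => w i * |P| * ε) (|P| * ε) := by
    simpa [mul_assoc] using hw1.mul_right (|P| * ε)
  rw [← hs.tsum_eq, ← Real.norm_eq_abs]
  refine tsum_of_norm_bounded hB fun i => ?_
  have e : b i - P * (w i * c i) = b i - w i * P * c i := by ring
  rw [e]
  exact h i

section AffineSystem

variable {r : ℕ} {I : Type*} {α a : I → Fin r → ℝ} {γ : I → (Fin r → ℝ) → (Fin r → ℝ)}

theorem prod_affine_sub (hγ : ∀ i x n, γ i x n = α i n * x n + a i n) (i : I)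
    (y z : Fin r → ℝ) :
    ∏ n, (γ i z n - γ i y n) = (∏ n, α i n) * ∏ n, (z n - y n) := by
  rw [← Finset.prod_mul_distrib]
  refine Finset.prod_congr rfl fun n _ => ?_
  rw [hγ, hγ]; ring

theorem norm_affine_sub_le (hα : ∀ i n, 0 < α i n ∧ α i n < 1) {q : ℝ} (hq0 : 0 ≤ q)
    (hqb : ∀ i n, α i n ≤ q) (hγ : ∀ i x n, γ i x n = α i n * x n + a i n) (i : I)
    (y z : Fin r → ℝ) : ‖γ i z - γ i y‖ ≤ q * ‖z - y‖ := by
  refine (pi_norm_le_iff_of_nonneg (by positivity)).2 fun n => ?_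
  have e : (γ i z - γ i y) n = α i n * (z - y) n := by
    simp only [Pi.sub_apply, hγ]; ring
  rw [e, norm_mul, Real.norm_of_nonneg (hα i n).1.le]
  exact mul_le_mul (hqb i n) (norm_le_pi_norm _ n) (norm_nonneg _) hq0

theorem affine_ite (hγ : ∀ i x n, γ i x n = α i n * x n + a i n) (i : I)
    (M : Finset (Fin r)) (y z : Fin r → ℝ) :
    γ i (fun n => if n ∈ M then y n else z n) =
      fun n => if n ∈ M then γ i y n else γ i z n := by
  funext n
  by_cases hn : n ∈ M <;> simp [hγ, hn]

theorem mwPi_affine_subset (hγ : ∀ i x n, γ i x n = α i n * x n + a i n)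
    {X : Set (Fin r → ℝ)} (hXadm : ∀ x ∈ X, ∀ i, mwPi (γ i 0) (γ i x) ⊆ X)
    {y z : Fin r → ℝ} (hyz : mwPi y z ⊆ X) (i : I) : mwPi (γ i y) (γ i z) ⊆ X := by
  classical
  intro u hu
  let v : Fin r → ℝ := fun n => if u n = γ i y n then y n else z n
  have hv : v ∈ X := hyz fun n => by
    by_cases hn : u n = γ i y n <;> simp [v, hn]
  refine hXadm v hv i fun n => Or.inr ?_
  by_cases hn : u n = γ i y n
  · simp [v, hγ, hn]
  · rw [(hu n).resolve_left hn]
    rw [hγ, hγ]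
    simp only [v, hn, if_false]

/-- The fixed point equation propagates to increments over boxes with vertices in `X`. -/
theorem hasSum_mwBoxIncr_affine (hγ : ∀ i x n, γ i x n = α i n * x n + a i n)
    {X : Set (Fin r → ℝ)} {f : (Fin r → ℝ) → ℝ}
    (hfix : ∀ x ∈ X, HasSum (fun i => mwBoxIncr f (γ i 0) (γ i x)) (f x))
    {y z : Fin r → ℝ} (hyz : mwPi y z ⊆ X) :
    HasSum (fun i => mwBoxIncr f (γ i y) (γ i z)) (mwBoxIncr f y z) := by
  have h : HasSum (fun i => ∑ M : Finset (Fin r), (-1 : ℝ) ^ M.card *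
      mwBoxIncr f (γ i 0) (γ i (fun n => if n ∈ M then y n else z n))) (mwBoxIncr f y z) := by
    refine hasSum_sum fun M _ => (hfix _ (hyz fun n => ?_)).mul_left _
    by_cases hn : n ∈ M <;> simp [hn]
  simpa only [affine_ite hγ, sum_mwBoxIncr_eq] using h

theorem abs_mwBoxIncr_sub_le (hα : ∀ i n, 0 < α i n ∧ α i n < 1) {q : ℝ} (hq0 : 0 ≤ q)
    (hqb : ∀ i n, α i n ≤ q) (hγ : ∀ i x n, γ i x n = α i n * x n + a i n)
    (hw1 : HasSum (fun i => ∏ n, α i n) 1)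
    {T : Set (Fin r → ℝ)} (hT : ∀ x ∈ T, ∀ i, γ i x ∈ T)
    {X : Set (Fin r → ℝ)} (hXadm : ∀ x ∈ X, ∀ i, mwPi (γ i 0) (γ i x) ⊆ X)
    {f : (Fin r → ℝ) → ℝ} (hf : mwIsCN f)
    (hfix : ∀ x ∈ X, HasSum (fun i => mwBoxIncr f (γ i 0) (γ i x)) (f x))
    {C δ ε : ℝ} (hC : ∀ x ∈ T, |mwDN f x| ≤ C)
    (hε : ∀ u ∈ T, ∀ v, ‖v - u‖ ≤ δ → |mwDN f v - mwDN f u| ≤ ε) :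
    ∀ (p : ℕ) (y z : Fin r → ℝ), y ∈ T → mwPi y z ⊆ X → q ^ p * ‖z - y‖ ≤ δ →
      |mwBoxIncr f y z - (∏ n, (z n - y n)) *
        averageIter (fun i => ∏ n, α i n) γ (mwDN f) p y| ≤ |∏ n, (z n - y n)| * ε
  | 0, y, z, hy, _, hd => by
    obtain ⟨ξ, hξ, h⟩ := exists_mwBoxIncr_eq_prod_mul_mwDN hf y z
    rw [h, averageIter, ← mul_sub, abs_mul]
    refine mul_le_mul_of_nonneg_left (hε y hy ξ (le_trans ?_ hd)) (abs_nonneg _)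
    rw [pow_zero, one_mul]
    refine (pi_norm_le_iff_of_nonneg (norm_nonneg _)).2 fun n => ?_
    exact (Set.abs_sub_left_of_mem_uIcc (hξ n)).trans (norm_le_pi_norm (z - y) n)
  | p + 1, y, z, hy, hyz, hd => by
    have hw : ∀ i, 0 ≤ ∏ n, α i n := fun i => Finset.prod_nonneg fun n _ => (hα i n).1.le
    refine (hasSum_mwBoxIncr_affine hγ hfix hyz).abs_sub_mul_tsum_le hw1
      (summable_mul_averageIter hw hw1 hT hC p hy) fun i => ?_
    have := abs_mwBoxIncr_sub_le hα hq0 hqb hγ hw1 hT hXadm hf hfix hC hε p (γ i y) (γ i z)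
      (hT y hy i) (mwPi_affine_subset hγ hXadm hyz i) (le_trans (by
        rw [pow_succ, mul_assoc]
        exact mul_le_mul_of_nonneg_left (norm_affine_sub_le hα hq0 hqb hγ i y z)
          (pow_nonneg hq0 p)) hd)
    rwa [prod_affine_sub hγ, abs_mul, abs_of_nonneg (hw i)] at this

theorem volume_affine_image (hα : ∀ i n, 0 < α i n ∧ α i n < 1)
    (hγ : ∀ i x n, γ i x n = α i n * x n + a i n) (i : I) (T : Set (Fin r → ℝ)) :
    volume (γ i '' T) = ENNReal.ofReal (∏ n, α i n) * volume T := by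
  have e : γ i = (fun x => x + a i) ∘ Matrix.toLin' (Matrix.diagonal (α i)) := by
    funext x n
    simp [hγ, Matrix.mulVec_diagonal]
  rw [e, Set.image_comp, Set.image_add_right, measure_preimage_add_right,
    Measure.addHaar_image_linearMap, LinearMap.det_toLin', Matrix.det_diagonal,
    abs_of_nonneg (Finset.prod_nonneg fun n _ => (hα i n).1.le)]

theorem hasSum_prod_ratio [Countable I] (hα : ∀ i n, 0 < α i n ∧ α i n < 1)
    (hγ : ∀ i x n, γ i x n = α i n * x n + a i n)
    {T : Set (Fin r → ℝ)} (hTc : IsCompact T) (hTpos : 0 < volume T)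
    (hdisj : ∀ i j : I, i ≠ j → volume (γ i '' T ∩ γ j '' T) = 0)
    (hsymm : volume (symmDiff T (⋃ i, γ i '' T)) = 0) :
    HasSum (fun i => ∏ n, α i n) 1 := by
  have hcont : ∀ i, Continuous (γ i) := fun i => by
    refine continuous_pi fun n => ?_
    simp only [hγ]
    fun_prop
  have hw : ∀ i, 0 ≤ ∏ n, α i n := fun i => Finset.prod_nonneg fun n _ => (hα i n).1.le
  have h : volume T = ∑' i, ENNReal.ofReal (∏ n, α i n) * volume T := by
    simp only [← volume_affine_image hα hγ]
    rw [measure_congr (measure_symmDiff_eq_zero_iff.1 hsymm)]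
    exact measure_iUnion₀ (fun i j h => hdisj i j h)
      fun i => (hTc.image (hcont i)).measurableSet.nullMeasurableSet
  rw [ENNReal.tsum_mul_right] at h
  have h1 : ∑' i, ENNReal.ofReal (∏ n, α i n) = 1 :=
    (ENNReal.mul_left_inj hTpos.ne' hTc.measure_lt_top.ne).1 (by rw [← h, one_mul])
  have hs : Summable fun i => ∏ n, α i n := by
    have := ENNReal.summable_toReal (f := fun i => ENNReal.ofReal (∏ n, α i n)) (by simp [h1])
    simpa only [ENNReal.toReal_ofReal (hw _)] using this
  have h2 : ∑' i, ∏ n, α i n = 1 := by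
    rw [← ENNReal.ofReal_tsum_of_nonneg hw hs] at h1
    exact ENNReal.ofReal_eq_one.1 h1
  exact h2 ▸ hs.hasSum

open Filter Topology in
/-- A fixed point of the MW-operator is approximated by multiples of the product function. -/
theorem tendsto_prod_mul_averageIter (hα : ∀ i n, 0 < α i n ∧ α i n < 1) {q : ℝ} (hq0 : 0 ≤ q)
    (hqb : ∀ i n, α i n ≤ q) (hq1 : q < 1) (hγ : ∀ i x n, γ i x n = α i n * x n + a i n)
    (hw1 : HasSum (fun i => ∏ n, α i n) 1)
    {T : Set (Fin r → ℝ)} (hTc : IsCompact T) (hT0 : 0 ∈ T) (hT : ∀ x ∈ T, ∀ i, γ i x ∈ T)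
    {X : Set (Fin r → ℝ)} (hXadm : ∀ x ∈ X, ∀ i, mwPi (γ i 0) (γ i x) ⊆ X)
    {f : (Fin r → ℝ) → ℝ} (hf : mwIsCN f)
    (hfix : ∀ x ∈ X, HasSum (fun i => mwBoxIncr f (γ i 0) (γ i x)) (f x))
    {x : Fin r → ℝ} (hx : x ∈ X) :
    Tendsto (fun p => (∏ n, x n) *
      averageIter (fun i => ∏ n, α i n) γ (mwDN f) (p + 1) 0) atTop (𝓝 (f x)) := by
  have hg : Continuous (mwDN f) := (hf Finset.univ).2
  have hw : ∀ i, 0 ≤ ∏ n, α i n := fun i => Finset.prod_nonneg fun n _ => (hα i n).1.le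
  obtain ⟨C, hC⟩ := hTc.exists_bound_of_continuousOn hg.continuousOn
  rw [Metric.tendsto_atTop]
  intro ε hε
  set P := ∏ n, x n with hP
  have hη : 0 < ε / (|P| + 1) := by positivity
  obtain ⟨δ, hδ, hu⟩ : ∃ δ > 0, ∀ u ∈ T, ∀ v, ‖v - u‖ ≤ δ →
      |mwDN f v - mwDN f u| ≤ ε / (|P| + 1) := by
    have := hTc.uniformContinuousAt_of_continuousAt (mwDN f) (fun u _ => hg.continuousAt)
      (Metric.dist_mem_uniformity hη)
    obtain ⟨δ, hδ, h⟩ := Metric.mem_uniformity_dist.1 this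
    refine ⟨δ / 2, half_pos hδ, fun u hu v hv => ?_⟩
    have := h (a := u) (b := v) (by rw [dist_comm, dist_eq_norm]; linarith) hu
    rw [abs_sub_comm]
    exact (Set.mem_ofPred.1 this).le
  have ht : Tendsto (fun p : ℕ => q ^ p * (q * ‖x‖)) atTop (𝓝 0) := by
    simpa using (tendsto_pow_atTop_nhds_zero_of_lt_one hq0 hq1).mul_const (q * ‖x‖)
  obtain ⟨p₀, hp₀⟩ := eventually_atTop.1 (ht.eventually_le_const hδ)
  refine ⟨p₀, fun p hp => ?_⟩
  have key : |f x - P * ∑' i, (∏ n, α i n) *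
      averageIter (fun i => ∏ n, α i n) γ (mwDN f) p (γ i 0)| ≤ |P| * (ε / (|P| + 1)) := by
    refine (hfix x hx).abs_sub_mul_tsum_le hw1
      (summable_mul_averageIter hw hw1 hT hC p hT0) fun i => ?_
    have := abs_mwBoxIncr_sub_le hα hq0 hqb hγ hw1 hT hXadm hf hfix hC hu p (γ i 0) (γ i x)
      (hT 0 hT0 i) (hXadm x hx i) (le_trans (mul_le_mul_of_nonneg_left
        (by simpa using norm_affine_sub_le hα hq0 hqb hγ i 0 x) (pow_nonneg hq0 p)) (hp₀ p hp))
    rw [prod_affine_sub hγ, abs_mul, abs_of_nonneg (hw i)] at this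
    simpa using this
  rw [dist_comm, Real.dist_eq]
  refine key.trans_lt ?_
  rw [mul_div_assoc', div_lt_iff₀ (by positivity)]
  nlinarith [abs_nonneg P]

end AffineSystem

/-- a function on an admissible set `X` extending to a `C^N`-function
satisfies `𝕄f = f` on `X` iff `f(x) = λ ∏_n x_n` on `X` for some `λ ∈ ℝ`. -/
theorem stmt11 {r : ℕ} (hr : 0 < r) {I : Type*} [Countable I] [Nontrivial I]
    (α a : I → Fin r → ℝ) (q : ℝ)
    (hα : ∀ i n, 0 < α i n ∧ α i n < 1)
    (hqb : ∀ i n, α i n ≤ q) (hq1 : q < 1)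
    (γ : I → (Fin r → ℝ) → (Fin r → ℝ))
    (hγ : ∀ i x n, γ i x n = α i n * x n + a i n)
    (T : Set (Fin r → ℝ)) (hTc : IsCompact T)
    (hT0 : (0 : Fin r → ℝ) ∈ T)
    (hTadm : ∀ x ∈ T, ∀ i, mwPi (γ i 0) (γ i x) ⊆ T)
    (hTpos : 0 < volume T)
    (hdisj : ∀ i j : I, i ≠ j → volume (γ i '' T ∩ γ j '' T) = 0)
    (hsymm : volume (symmDiff T (⋃ i, γ i '' T)) = 0)
    (hclos : T = closure (⋃ i, γ i '' T))
    (X : Set (Fin r → ℝ))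
    (hX0 : (0 : Fin r → ℝ) ∈ X)
    (hXadm : ∀ x ∈ X, ∀ i, mwPi (γ i 0) (γ i x) ⊆ X)
    (f : (Fin r → ℝ) → ℝ) (hf : mwIsCN f) :
    ((∀ x ∈ X, Summable (fun i : I => |mwBoxIncr f (γ i 0) (γ i x)|)) ∧
      (∀ x ∈ X, ∑' i : I, mwBoxIncr f (γ i 0) (γ i x) = f x)) ↔
    ∃ lam : ℝ, ∀ x ∈ X, f x = lam * ∏ n, x n := by
  have hw1 := hasSum_prod_ratio hα hγ hTc hTpos hdisj hsymm
  constructor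
  · rintro ⟨hsum, hfix⟩
    have hfix' : ∀ x ∈ X, HasSum (fun i => mwBoxIncr f (γ i 0) (γ i x)) (f x) := fun x hx =>
      hfix x hx ▸ (hsum x hx).of_abs.hasSum
    have hT : ∀ x ∈ T, ∀ i, γ i x ∈ T := fun x hx i => hTadm x hx i fun n => Or.inr rfl
    obtain ⟨i₀⟩ : Nonempty I := inferInstance
    have hq0 : 0 ≤ q := (hα i₀ ⟨0, hr⟩).1.le.trans (hqb i₀ ⟨0, hr⟩)
    have hlim := fun x (hx : x ∈ X) => tendsto_prod_mul_averageIter hα hq0 hqb hq1 hγ hw1 hTc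
      hT0 hT hXadm hf hfix' hx
    by_cases h : ∃ x₀ ∈ X, ∏ n, x₀ n ≠ 0
    · obtain ⟨x₀, hx₀, hne⟩ := h
      refine ⟨f x₀ / ∏ n, x₀ n, fun x hx => tendsto_nhds_unique (hlim x hx) ?_⟩
      have := ((hlim x₀ hx₀).div_const (∏ n, x₀ n)).mul_const (∏ n, x n)
      refine this.congr fun p => ?_
      field_simp
    · push Not at h
      refine ⟨0, fun x hx => tendsto_nhds_unique (hlim x hx) ?_⟩
      simp [h x hx]
  · rintro ⟨lam, hlam⟩
    have hbox : ∀ x ∈ X, ∀ i, mwBoxIncr f (γ i 0) (γ i x) = (∏ n, α i n) * f x := by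
      intro x hx i
      rw [mwBoxIncr_congr fun z hz => hlam z (hXadm x hx i hz), mwBoxIncr_mul_prod,
        prod_affine_sub hγ, hlam x hx]
      simp only [Pi.zero_apply, sub_zero]
      ring
    have hs : ∀ x ∈ X, HasSum (fun i => mwBoxIncr f (γ i 0) (γ i x)) (f x) := fun x hx => by
      simpa only [hbox x hx, one_mul] using hw1.mul_right (f x)
    exact ⟨fun x hx => (hs x hx).summable.abs, fun x hx => (hs x hx).tsum_eq⟩
end
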